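/- arXiv:2601.11765 — 8 statements merged into one kernel-verified Lean document; each statement's English description precedes it below -/
import Mathlib

section
/- Let n and k be positive integers with k ≤ n, and set ℓ* = ⌊log₂(n/k)⌋. Each of the n data points is independently assigned a random level ℓ_i ∈ {1,2,3,…} with Pr(ℓ_i = ℓ) = 2^{-ℓ}. Let |U| = ∑_{ℓ≥1} min(C_{ℓ,n}, k), where C_{ℓ,n} is the number of points assigned to level ℓ. Then E[|U|] ≤ (ℓ* + 2)·k. -/
open MeasureTheory
open scoped ENNReal

/-- `levelCount n L ℓ i` is `C_{ℓ,i}`: the number of points among the first `i`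
(i.e. those `j : Fin n` with `(j : ℕ) < i`) assigned to level `ℓ` by `L`. -/
def levelCount (n : ℕ) (L : Fin n → ℕ) (ℓ : ℕ) (i : ℕ) : ℕ :=
  (Finset.univ.filter (fun j : Fin n => (j : ℕ) < i ∧ L j = ℓ)).card

/-- The part of `|U|` coming from the levels `1, …, m` is at most `m * k`; the part coming from the
higher levels is at most the number of points assigned to them. -/
lemma tsum_min_levelCount_le (n k m : ℕ) (L : Fin n → ℕ) :
    (∑' ℓ : ℕ, (min (levelCount n L (ℓ + 1) n) k : ℝ))
      ≤ m * k + ∑ j : Fin n, (Set.Ioi m).indicator (fun _ => (1 : ℝ)) (L j) := by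
  set N := m + ∑ j, L j with hN
  have hLN (j : Fin n) : L j ≤ N :=
    (Finset.single_le_sum (f := L) (fun _ _ => Nat.zero_le _) (Finset.mem_univ j)).trans
      (Nat.le_add_left _ _)
  have hcount (ℓ : ℕ) :
      (levelCount n L (ℓ + 1) n : ℝ) = ∑ j : Fin n, if L j = ℓ + 1 then (1 : ℝ) else 0 := by
    simp [levelCount]
  rw [tsum_eq_sum (s := Finset.range N), ← Finset.sum_range_add_sum_Ico _ (Nat.le_add_right m _)]
  · refine add_le_add ?_ ?_
    · refine (Finset.sum_le_card_nsmul _ _ (k : ℝ) fun ℓ _ => min_le_right _ _).trans ?_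
      simp
    · refine (Finset.sum_le_sum fun ℓ _ => min_le_left _ _).trans ?_
      simp_rw [hcount]
      rw [Finset.sum_comm]
      refine Finset.sum_le_sum fun j _ => ?_
      by_cases hj : m < L j
      · rw [Set.indicator_of_mem (Set.mem_Ioi.2 hj), Finset.sum_eq_single_of_mem (L j - 1)]
        · split_ifs <;> norm_num
        · have := hLN j
          simp only [Finset.mem_Ico]
          omega
        · intro ℓ _ hℓ
          rw [if_neg]
          omega
      · rw [Set.indicator_of_notMem (by simpa using hj)]
        refine (Finset.sum_eq_zero fun ℓ hℓ => ?_).le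
        rw [Finset.mem_Ico] at hℓ
        rw [if_neg]
        omega
  · intro ℓ hℓ
    rw [Finset.mem_range] at hℓ
    have : (levelCount n L (ℓ + 1) n : ℝ) = 0 := by
      rw [hcount]
      refine Finset.sum_eq_zero fun j _ => ?_
      have := hLN j
      rw [if_neg]
      omega
    rw [this]
    exact min_eq_left (Nat.cast_nonneg k)

/-- The tail of the geometric distribution on `{1, 2, …}` with parameter `1 / 2`. -/
lemma measureReal_Ioi_of_geometric (ν : Measure ℕ) [IsProbabilityMeasure ν] (hν0 : ν {0} = 0)
    (hν : ∀ ℓ : ℕ, 1 ≤ ℓ → ν {ℓ} = (1 / 2 : ℝ≥0∞) ^ ℓ) (m : ℕ) :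
    ν.real (Set.Ioi m) = (1 / 2 : ℝ) ^ m := by
  induction m with
  | zero =>
    have h : Set.Ioi 0 = ({0} : Set ℕ)ᶜ := by
      ext x
      simp [Nat.pos_iff_ne_zero]
    rw [h, probReal_compl_eq_one_sub (measurableSet_singleton 0)]
    simp [measureReal_def, hν0]
  | succ m ih =>
    have h : Set.Ioi m = {m + 1} ∪ Set.Ioi (m + 1) := by
      ext x
      simp only [Set.mem_Ioi, Set.mem_union, Set.mem_singleton_iff]
      omega
    have hs : ν.real {m + 1} = (1 / 2 : ℝ) ^ (m + 1) := by
      simp [measureReal_def, hν (m + 1) (by omega)]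
    rw [h, measureReal_union (by simp) measurableSet_Ioi, hs] at ih
    rw [pow_succ] at ih ⊢
    linarith

/-- Let `n, k` be positive integers with `k ≤ n`, and
`ℓ* = ⌊log₂(n/k)⌋`. Each of the `n` data points is independently assigned a random level
`ℓ ∈ {1,2,3,…}` with `Pr(ℓ) = 2^{−ℓ}` (the levels are encoded by the product measure
`Measure.pi (fun _ => ν)` of a probability measure `ν` on `ℕ` with `ν {0} = 0` and
`ν {ℓ} = 2^{−ℓ}` for `ℓ ≥ 1`). Let `|U| = ∑_{ℓ ≥ 1} min(C_{ℓ,n}, k)` where `C_{ℓ,n}` is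
the number of points assigned to level `ℓ`. Then `E[|U|] ≤ (ℓ* + 2)·k`. -/
theorem stmt_0 (n k : ℕ) (hn : 0 < n) (hk : 0 < k) (hkn : k ≤ n)
    (ν : Measure ℕ) [IsProbabilityMeasure ν] (hν0 : ν {0} = 0)
    (hν : ∀ ℓ : ℕ, 1 ≤ ℓ → ν {ℓ} = (1 / 2 : ℝ≥0∞) ^ ℓ) :
    ∫ L : Fin n → ℕ, (∑' ℓ : ℕ, (min (levelCount n L (ℓ + 1) n) k : ℝ))
        ∂(Measure.pi fun _ : Fin n => ν)
      ≤ ((⌊Real.logb 2 ((n : ℝ) / (k : ℝ))⌋ : ℝ) + 2) * (k : ℝ) := by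
  have hk' : (0 : ℝ) < k := by exact_mod_cast hk
  have hx : (1 : ℝ) ≤ n / k := by
    rw [one_le_div hk']
    exact_mod_cast hkn
  obtain ⟨m, hm⟩ : ∃ m : ℕ, ⌊Real.logb 2 ((n : ℝ) / k)⌋ = m :=
    Int.eq_ofNat_of_zero_le (Int.floor_nonneg.2 (Real.logb_nonneg one_lt_two hx))
  have hlt : (n : ℝ) / k < 2 ^ (m + 1) := by
    have h := Int.lt_floor_add_one (Real.logb 2 ((n : ℝ) / k))
    rw [hm, Real.logb_lt_iff_lt_rpow one_lt_two (by linarith)] at h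
    exact_mod_cast h
  have htail : (n : ℝ) * (1 / 2) ^ m ≤ 2 * k := by
    rw [div_lt_iff₀ hk', pow_succ] at hlt
    rw [one_div, inv_pow, ← div_eq_mul_inv, div_le_iff₀ (by positivity)]
    linarith
  set μ : Measure (Fin n → ℕ) := Measure.pi fun _ => ν
  have hpres (j : Fin n) : MeasurePreserving (Function.eval j) μ ν :=
    measurePreserving_eval (fun _ => ν) j
  have hint : Integrable ((Set.Ioi m).indicator fun _ => (1 : ℝ)) ν :=
    (integrable_const 1).indicator measurableSet_Ioi
  have hintj (j : Fin n) :
      Integrable (fun L : Fin n → ℕ => (Set.Ioi m).indicator (fun _ => (1 : ℝ)) (L j)) μ :=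
    (hpres j).integrable_comp_of_integrable hint
  have hval (j : Fin n) :
      ∫ L, (Set.Ioi m).indicator (fun _ => (1 : ℝ)) (L j) ∂μ = (1 / 2) ^ m := by
    rw [← measureReal_Ioi_of_geometric ν hν0 hν m, ← integral_indicator_one measurableSet_Ioi,
      ← (hpres j).map_eq, integral_map (hpres j).aemeasurable (by
        rw [(hpres j).map_eq]
        exact hint.aestronglyMeasurable)]
    rfl
  have hsum := integrable_finsetSum Finset.univ fun j _ => hintj j
  calc _ ≤ ∫ L, (m * k + ∑ j : Fin n, (Set.Ioi m).indicator (fun _ => (1 : ℝ)) (L j)) ∂μ := by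
        refine integral_mono_of_nonneg (.of_forall fun L => tsum_nonneg fun ℓ => ?_)
          ((integrable_const _).add hsum) (.of_forall (tsum_min_levelCount_le n k m))
        positivity
    _ = m * k + n * (1 / 2) ^ m := by
        rw [integral_add (integrable_const _) hsum, integral_finsetSum _ fun j _ => hintj j]
        simp_rw [hval]
        simp
    _ ≤ _ := by
        rw [hm]
        push_cast
        linarith
end

section
/- Let k ≥ 1 and let f_1 ≥ f_2 ≥ … ≥ f_n ≥ 0 be nonnegative reals. With levels ℓ_1,…,ℓ_n independently distributed as Pr(ℓ_i = ℓ) = 2^{-ℓ}, define I_i = 1 if C_{ℓ_i,i-1} < k and 0 otherwise, and p_i = ∑_{ℓ ≥ 1 : C_{ℓ,i-1} < k} 2^{-ℓ} (which is almost surely positive). Then the estimator E = ∑_{i=1}^n (I_i/p_i)·f_i is unbiased: its expectation over the random levels equals F = ∑_{i=1}^n f_i. -/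
open MeasureTheory
open scoped ENNReal

/-- `pVal n k L m` is `p_i` for the point with `m = i − 1` previous points:
`∑_{ℓ ≥ 1 : C_{ℓ,m} < k} 2^{−ℓ}` (the sum over levels `ℓ ≥ 1` is written as a
`tsum` over `ℓ : ℕ` of the term at level `ℓ + 1`). -/
noncomputable def pVal (n k : ℕ) (L : Fin n → ℕ) (m : ℕ) : ℝ :=
  ∑' ℓ : ℕ, if levelCount n L (ℓ + 1) m < k then (1 / 2 : ℝ) ^ (ℓ + 1) else 0

/-- `IVal n k L i` is the indicator `I_i = 1[C_{ℓ_i, i−1} < k]` for the point `i : Fin n`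
(0-based, so it has `(i : ℕ)` previous points). -/
noncomputable def IVal (n k : ℕ) (L : Fin n → ℕ) (i : Fin n) : ℝ :=
  if levelCount n L (L i) (i : ℕ) < k then 1 else 0

theorem levelCount_update_self (n : ℕ) (L : Fin n → ℕ) (i : Fin n) (a ℓ : ℕ) :
    levelCount n (Function.update L i a) ℓ i = levelCount n L ℓ i := by
  unfold levelCount
  congr 1
  refine Finset.filter_congr fun j _ => and_congr_right fun hj => ?_
  rw [Function.update_of_ne (by rintro rfl; exact lt_irrefl _ hj)]

theorem pVal_update_self (n k : ℕ) (L : Fin n → ℕ) (i : Fin n) (a : ℕ) :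
    pVal n k (Function.update L i a) i = pVal n k L i := by
  simp only [pVal, levelCount_update_self]

theorem IVal_update_self (n k : ℕ) (L : Fin n → ℕ) (i : Fin n) (a : ℕ) :
    IVal n k (Function.update L i a) i = if levelCount n L a i < k then 1 else 0 := by
  simp only [IVal, levelCount_update_self, Function.update_self]

theorem summable_pVal (n k : ℕ) (L : Fin n → ℕ) (m : ℕ) :
    Summable fun ℓ : ℕ =>
      if levelCount n L (ℓ + 1) m < k then (1 / 2 : ℝ) ^ (ℓ + 1) else 0 := by
  refine Summable.of_nonneg_of_le (fun ℓ => by positivity) (fun ℓ => ?_)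
    ((summable_nat_add_iff 1).2 summable_geometric_two)
  split_ifs
  · exact le_rfl
  · positivity

theorem pVal_pos (n k : ℕ) (hk : 1 ≤ k) (L : Fin n → ℕ) (m : ℕ) : 0 < pVal n k L m := by
  have hcount : levelCount n L (Finset.univ.sup L + 1) m = 0 := by
    simp only [levelCount, Finset.card_eq_zero, Finset.filter_eq_empty_iff]
    rintro j - ⟨-, hj⟩
    have := Finset.le_sup (f := L) (Finset.mem_univ j)
    omega
  refine (summable_pVal n k L m).tsum_pos (fun ℓ => by positivity) (Finset.univ.sup L) ?_
  rw [hcount, if_pos (by omega)]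
  positivity

theorem measure_levelCount_lt (n k : ℕ) (L : Fin n → ℕ) (m : ℕ) (ν : Measure ℕ)
    (hν0 : ν {0} = 0) (hν : ∀ ℓ : ℕ, 1 ≤ ℓ → ν {ℓ} = (1 / 2 : ℝ≥0∞) ^ ℓ) :
    ν {a | levelCount n L a m < k} = ENNReal.ofReal (pVal n k L m) := by
  rw [← Measure.tsum_indicator_apply_singleton ν _ (MeasurableSet.of_discrete), pVal,
    ENNReal.ofReal_tsum_of_nonneg (fun ℓ => by positivity) (summable_pVal n k L m),
    tsum_eq_zero_add' ENNReal.summable]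
  have h0 : Set.indicator {a | levelCount n L a m < k} (fun x => ν {x}) 0 = 0 := by
    simp [Set.indicator_apply, hν0]
  rw [h0, zero_add]
  refine tsum_congr fun ℓ => ?_
  simp only [Set.indicator_apply, Set.mem_ofPred_eq]
  split_ifs
  · rw [hν _ (by omega), ENNReal.ofReal_pow (by norm_num),
      ENNReal.ofReal_div_of_pos (by norm_num)]
    simp
  · simp

theorem lintegral_IVal_div_pVal (n k : ℕ) (hk : 1 ≤ k) (ν : Measure ℕ) [IsProbabilityMeasure ν]
    (hν0 : ν {0} = 0) (hν : ∀ ℓ : ℕ, 1 ≤ ℓ → ν {ℓ} = (1 / 2 : ℝ≥0∞) ^ ℓ) (i : Fin n) :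
    ∫⁻ L : Fin n → ℕ, ENNReal.ofReal (IVal n k L i / pVal n k L i)
      ∂(Measure.pi fun _ : Fin n => ν) = 1 := by
  have hinner : (∫⋯∫⁻_{i}, (fun L : Fin n → ℕ => ENNReal.ofReal (IVal n k L i / pVal n k L i))
      ∂fun _ => ν) = fun _ => 1 := by
    funext L
    have hp := pVal_pos n k hk L i
    rw [lmarginal_singleton]
    have h : ∀ a : ℕ, ENNReal.ofReal (IVal n k (Function.update L i a) i /
        pVal n k (Function.update L i a) i) =
        {a | levelCount n L a i < k}.indicator
          (fun _ => (ENNReal.ofReal (pVal n k L i))⁻¹) a := by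
      intro a
      rw [IVal_update_self, pVal_update_self, ENNReal.ofReal_div_of_pos hp]
      by_cases ha : levelCount n L a i < k <;> simp [ha]
    simp only [h]
    rw [lintegral_indicator_const MeasurableSet.of_discrete,
      measure_levelCount_lt n k L i ν hν0 hν,
      ENNReal.inv_mul_cancel (by simpa using hp) ENNReal.ofReal_ne_top]
  rw [lintegral_eq_lmarginal_univ (fun _ => 0),
    ← Finset.insert_erase (Finset.mem_univ i),
    lmarginal_insert' _ Measurable.of_discrete (Finset.notMem_erase i _)]
  rw [lmarginal_singleton] at hinner
  simp only [hinner]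
  simp [lmarginal]

/-- Let `k ≥ 1` and let `f_1 ≥ f_2 ≥ … ≥ f_n ≥ 0` be nonnegative reals.
With levels `ℓ_1,…,ℓ_n` independently distributed as `Pr(ℓ_i = ℓ) = 2^{−ℓ}` (encoded by
the product measure `Measure.pi (fun _ => ν)` of a probability measure `ν` on `ℕ` with
`ν {0} = 0` and `ν {ℓ} = 2^{−ℓ}` for `ℓ ≥ 1`), define `I_i = 1[C_{ℓ_i,i−1} < k]` and
`p_i = ∑_{ℓ ≥ 1 : C_{ℓ,i−1} < k} 2^{−ℓ}`. Then the estimator `E = ∑ (I_i/p_i)·f_i` is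
unbiased: its expectation over the random levels equals `F = ∑ f_i`. -/
theorem stmt_2 (n k : ℕ) (hk : 1 ≤ k)
    (f : Fin n → ℝ) (hmono : ∀ i j : Fin n, i ≤ j → f j ≤ f i) (hf : ∀ i, 0 ≤ f i)
    (ν : Measure ℕ) [IsProbabilityMeasure ν] (hν0 : ν {0} = 0)
    (hν : ∀ ℓ : ℕ, 1 ≤ ℓ → ν {ℓ} = (1 / 2 : ℝ≥0∞) ^ ℓ) :
    ∫ L : Fin n → ℕ, (∑ i : Fin n, IVal n k L i / pVal n k L (i : ℕ) * f i)
        ∂(Measure.pi fun _ : Fin n => ν)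
      = ∑ i, f i := by
  have hmeas : ∀ i : Fin n, Measurable fun L : Fin n → ℕ => IVal n k L i / pVal n k L i :=
    fun i => Measurable.of_discrete
  have hnonneg : ∀ (i : Fin n) (L : Fin n → ℕ), 0 ≤ IVal n k L i / pVal n k L i :=
    fun i L => div_nonneg (by unfold IVal; split_ifs <;> simp) (pVal_pos n k hk L i).le
  have hint : ∀ i : Fin n, Integrable (fun L : Fin n → ℕ => IVal n k L i / pVal n k L i)
      (Measure.pi fun _ : Fin n => ν) := fun i => by
    refine ⟨(hmeas i).aestronglyMeasurable, ?_⟩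
    rw [hasFiniteIntegral_iff_ofReal (.of_forall (hnonneg i)),
      lintegral_IVal_div_pVal n k hk ν hν0 hν i]
    exact ENNReal.one_lt_top
  rw [integral_finsetSum _ fun i _ => (hint i).mul_const (f i)]
  refine Finset.sum_congr rfl fun i _ => ?_
  rw [integral_mul_const, integral_eq_lintegral_of_nonneg_ae (.of_forall (hnonneg i))
    (hmeas i).aestronglyMeasurable, lintegral_IVal_div_pVal n k hk ν hν0 hν i]
  simp
end

section
/- (Main theorem.) Let n, k be positive integers with k ≤ n, let δ ∈ (0,1), set ℓ* = ⌊log₂(n/k)⌋, assume k ≥ 8·log(3(ℓ*+3)/δ), and set b = k − ⌈√(2k·log(3(ℓ*+3)/δ))⌉. Let f_1 ≥ … ≥ f_n ≥ 0 with F = ∑_{i=1}^n f_i > 0, and let E = ∑_{i=1}^n (I_i/p_i)·f_i be the estimator built from levels ℓ_i independently distributed as Pr(ℓ_i = ℓ) = 2^{-ℓ}. Then with probability at least 1 − δ over the random levels, |E − F|/F ≤ √(3·log(3/δ)/(4b)) + 2·log(3/δ)/(3b). -/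
open MeasureTheory
open scoped ENNReal

/-- Sequential tensorisation: if each factor depends only on its own and earlier coordinates and
its integral in its own coordinate is bounded, the integral of the product is bounded. -/
theorem lintegral_prod_le_prod {n : ℕ} (ν : Measure ℕ) [IsProbabilityMeasure ν]
    (g : Fin n → (Fin n → ℕ) → ℝ≥0∞) (c : Fin n → ℝ≥0∞)
    (hdep : ∀ i j, i < j → ∀ L x, g i (Function.update L j x) = g i L)
    (hint : ∀ i L, ∫⁻ x, g i (Function.update L i x) ∂ν ≤ c i) (s : Finset (Fin n)) :
    ∫⁻ L, ∏ i ∈ s, g i L ∂(Measure.pi fun _ : Fin n => ν) ≤ ∏ i ∈ s, c i := by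
  induction s using Finset.induction_on_max with
  | empty => simp
  | insert a s ha ih =>
    have has : a ∉ s := fun h => lt_irrefl _ (ha a h)
    have hdep' : ∀ L x, ∏ i ∈ s, g i (Function.update L a x) = ∏ i ∈ s, g i L := fun L x =>
      Finset.prod_congr rfl fun i hi => hdep i a (ha i hi) L x
    have hm : ∀ h : (Fin n → ℕ) → ℝ≥0∞, Measurable h := fun _ => Measurable.of_discrete
    simp only [Finset.prod_insert has]
    calc ∫⁻ L, g a L * ∏ i ∈ s, g i L ∂(Measure.pi fun _ : Fin n => ν)
        ≤ ∫⁻ L, c a * ∏ i ∈ s, g i L ∂(Measure.pi fun _ : Fin n => ν) := by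
          rw [lintegral_eq_lmarginal_univ (fun _ => 0), lintegral_eq_lmarginal_univ (fun _ => 0),
            lmarginal_erase' _ (hm _) (Finset.mem_univ a),
            lmarginal_erase' _ (hm _) (Finset.mem_univ a)]
          refine lmarginal_mono (fun L => ?_) _
          simp only [hdep', lintegral_const, measure_univ, mul_one]
          rw [lintegral_mul_const _ Measurable.of_discrete]
          gcongr
          exact hint a L
      _ ≤ c a * ∏ i ∈ s, c i := by
          rw [lintegral_const_mul _ (hm _)]
          gcongr

theorem measure_le_sum_le {n : ℕ} (ν : Measure ℕ) [IsProbabilityMeasure ν]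
    (X : Fin n → (Fin n → ℕ) → ℝ) (c : Fin n → ℝ)
    (hdep : ∀ i j, i < j → ∀ L x, X i (Function.update L j x) = X i L)
    (hint : ∀ i L, ∫⁻ x, ENNReal.ofReal (Real.exp (X i (Function.update L i x))) ∂ν ≤
      ENNReal.ofReal (Real.exp (c i))) (t : ℝ) :
    (Measure.pi fun _ : Fin n => ν) {L | t ≤ ∑ i, X i L} ≤
      ENNReal.ofReal (Real.exp (∑ i, c i - t)) := by
  have h1 := lintegral_prod_le_prod ν (fun i L => ENNReal.ofReal (Real.exp (X i L)))
    (fun i => ENNReal.ofReal (Real.exp (c i)))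
    (fun i j hij L x => by simp only [hdep i j hij L x]) hint Finset.univ
  have h2 : {L | t ≤ ∑ i, X i L} ⊆ {L : Fin n → ℕ | ENNReal.ofReal (Real.exp t) ≤
      ∏ i, ENNReal.ofReal (Real.exp (X i L))} := by
    intro L hL
    simp only [Set.mem_ofPred_eq] at hL ⊢
    rw [← ENNReal.ofReal_prod_of_nonneg (fun _ _ => (Real.exp_pos _).le), ← Real.exp_sum]
    exact ENNReal.ofReal_le_ofReal (Real.exp_le_exp.2 hL)
  refine (measure_mono h2).trans ((meas_ge_le_lintegral_div
    Measurable.of_discrete.aemeasurable ?_ ENNReal.ofReal_ne_top).trans ?_)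
  · simp [Real.exp_pos]
  · rw [Real.exp_sub, Real.exp_sum, ENNReal.ofReal_div_of_pos (Real.exp_pos _),
      ENNReal.ofReal_prod_of_nonneg (fun _ _ => (Real.exp_pos _).le)]
    gcongr

theorem lintegral_ofReal_ite {Ω : Type*} [MeasurableSpace Ω] (ν : Measure Ω)
    [IsProbabilityMeasure ν] {S : Set Ω} [DecidablePred (· ∈ S)] (hS : MeasurableSet S) {x y : ℝ}
    (hx : 0 ≤ x) (hy : 0 ≤ y) :
    ∫⁻ ω, ENNReal.ofReal (if ω ∈ S then x else y) ∂ν =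
      ENNReal.ofReal (ν.real S * x + (1 - ν.real S) * y) := by
  rw [← lintegral_add_compl _ hS,
    setLIntegral_congr_fun (g := fun _ => ENNReal.ofReal x) hS (fun ω hω => by simp_all),
    setLIntegral_congr_fun (g := fun _ => ENNReal.ofReal y) hS.compl (fun ω hω => by simp_all),
    ← probReal_compl_eq_one_sub hS, setLIntegral_const, setLIntegral_const,
    ENNReal.ofReal_add (by positivity) (by positivity), ENNReal.ofReal_mul (by positivity),
    ENNReal.ofReal_mul (by positivity), ofReal_measureReal, ofReal_measureReal, mul_comm,
    mul_comm (ν Sᶜ)]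

theorem Real.exp_le_one_add_add_sq_div {u c : ℝ} (hc : 0 ≤ c) (hc3 : c < 3) (hu : u ≤ c) :
    Real.exp u ≤ 1 + u + u ^ 2 / (2 * (1 - c / 3)) := by
  rcases le_total u 0 with h | h
  · have key : Real.exp u ≤ 1 + u + u ^ 2 / 2 := by
      have hm : AntitoneOn (fun u : ℝ => 1 + u + u ^ 2 / 2 - Real.exp u) (Set.Iic 0) := by
        apply antitoneOn_of_deriv_nonpos (convex_Iic 0) (by fun_prop) (by fun_prop)
        intro x hx
        have : HasDerivAt (fun u : ℝ => 1 + u + u ^ 2 / 2 - Real.exp u)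
            (1 + x - Real.exp x) x := by
          have h1 := (((hasDerivAt_id x).const_add 1).add
            (((hasDerivAt_id x).pow 2).div_const 2)).sub (Real.hasDerivAt_exp x)
          exact h1.congr_deriv (by simp)
        rw [this.deriv]
        linarith [Real.add_one_le_exp x]
      have := hm (Set.mem_Iic.2 h) (Set.mem_Iic.2 le_rfl) h
      norm_num at this
      linarith
    refine key.trans (add_le_add le_rfl ?_)
    exact div_le_div_of_nonneg_left (sq_nonneg u) (by linarith) (by linarith)
  · have hm : MonotoneOn (fun u : ℝ => Real.exp (-u) * (6 + 4 * u + u ^ 2) + 2 * u)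
        (Set.Ici 0) := by
      apply monotoneOn_of_deriv_nonneg (convex_Ici 0) (by fun_prop) (by fun_prop)
      intro x hx
      have hx0 : 0 < x := by simpa using hx
      have : HasDerivAt (fun u : ℝ => Real.exp (-u) * (6 + 4 * u + u ^ 2) + 2 * u)
          (2 - Real.exp (-x) * (2 + 2 * x + x ^ 2)) x := by
        have h1 := ((hasDerivAt_neg x).exp.mul ((((hasDerivAt_id x).const_mul 4).const_add 6).add
            ((hasDerivAt_id x).pow 2))).add ((hasDerivAt_id x).const_mul 2)
        exact h1.congr_deriv (by simp; ring)
      rw [this.deriv]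
      have h2 := Real.quadratic_le_exp_of_nonneg hx0.le
      have h3 : Real.exp (-x) * Real.exp x = 1 := by rw [← Real.exp_add]; simp
      nlinarith [Real.exp_pos (-x)]
    have h1 := hm (Set.mem_Ici.2 le_rfl) (Set.mem_Ici.2 h) h
    have h3 : Real.exp (-u) * Real.exp u = 1 := by rw [← Real.exp_add]; simp
    have h4 : Real.exp u * (6 - 2 * u) ≤ 6 + 4 * u + u ^ 2 := by
      norm_num at h1
      nlinarith [Real.exp_pos u]
    have h5 : Real.exp u ≤ 1 + u + u ^ 2 / (2 * (1 - u / 3)) := by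
      have : 1 + u + u ^ 2 / (2 * (1 - u / 3)) = (6 + 4 * u + u ^ 2) / (6 - 2 * u) := by
        rw [show 2 * (1 - u / 3) = (6 - 2 * u) / 3 by ring]
        have : 3 - u ≠ 0 := by linarith
        rw [show 6 - 2 * u = 2 * (3 - u) by ring]
        field_simp
        ring
      rw [this, le_div_iff₀ (by linarith)]
      exact h4
    refine h5.trans (add_le_add le_rfl ?_)
    exact div_le_div_of_nonneg_left (sq_nonneg u) (by linarith) (by linarith)

/-- Bernstein's moment generating function bound for a centred two-point variable. -/
theorem bernstein_mgf_two_point {p x y M v θ : ℝ} (hp0 : 0 ≤ p) (hp1 : p ≤ 1)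
    (hmean : p * x + (1 - p) * y = 0) (hx : x ≤ M) (hy : y ≤ M) (hM : 0 ≤ M)
    (hvar : p * x ^ 2 + (1 - p) * y ^ 2 ≤ v) (hθ : 0 ≤ θ) (hθM : θ * M < 3) :
    p * Real.exp (θ * x) + (1 - p) * Real.exp (θ * y) ≤
      Real.exp (v * (θ ^ 2 / (2 * (1 - θ * M / 3)))) := by
  have hM' : 0 ≤ θ * M := by positivity
  have h1 := Real.exp_le_one_add_add_sq_div hM' hθM (mul_le_mul_of_nonneg_left hx hθ)
  have h2 := Real.exp_le_one_add_add_sq_div hM' hθM (mul_le_mul_of_nonneg_left hy hθ)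
  have hD : 0 ≤ θ ^ 2 / (2 * (1 - θ * M / 3)) :=
    div_nonneg (sq_nonneg _) (by linarith)
  have e : ∀ z : ℝ, (θ * z) ^ 2 / (2 * (1 - θ * M / 3)) =
    z ^ 2 * (θ ^ 2 / (2 * (1 - θ * M / 3))) := fun z => by ring
  rw [e] at h1 h2
  refine le_trans ?_ (Real.add_one_le_exp _)
  have h3 := mul_le_mul_of_nonneg_left h1 hp0
  have h4 := mul_le_mul_of_nonneg_left h2 (sub_nonneg.2 hp1)
  have h5 := mul_le_mul_of_nonneg_right hvar hD
  have h6 : θ * (p * x + (1 - p) * y) = 0 := by rw [hmean, mul_zero]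
  linear_combination h3 + h4 + h5 + h6

theorem bernstein_exponent_le {V M x : ℝ} (hV : 0 < V) (hM : 0 ≤ M) (hx : 0 < x) :
    ∃ θ, 0 ≤ θ ∧ θ * M < 3 ∧
      V * (θ ^ 2 / (2 * (1 - θ * M / 3))) - θ * (Real.sqrt (2 * V * x) + 2 * M * x / 3) ≤ -x := by
  set s := Real.sqrt (2 * V * x) with hs
  have hs0 : 0 ≤ s := Real.sqrt_nonneg _
  have hs2 : s ^ 2 = 2 * V * x := Real.sq_sqrt (by positivity)
  set t := s + 2 * M * x / 3 with ht
  have ht0 : 0 ≤ t := by positivity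
  have hD : 0 < V + M * t / 3 := by positivity
  refine ⟨t / (V + M * t / 3), by positivity, ?_, ?_⟩
  · rw [div_mul_eq_mul_div, div_lt_iff₀ hD]
    nlinarith
  · have e1 : 1 - t / (V + M * t / 3) * M / 3 = V / (V + M * t / 3) := by
      field_simp
      ring
    rw [e1]
    have e2 : V * ((t / (V + M * t / 3)) ^ 2 / (2 * (V / (V + M * t / 3)))) -
        t / (V + M * t / 3) * t = -(t ^ 2 / (2 * (V + M * t / 3))) := by
      field_simp
      ring
    rw [e2, neg_le_neg_iff, le_div_iff₀ (by positivity)]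
    have : 0 ≤ M * x * s := by positivity
    rw [ht]
    nlinarith

theorem log_le_sub_one_sub_sq {r : ℝ} (h0 : 0 < r) (h1 : r ≤ 1) :
    Real.log r ≤ (r - 1) - (1 - r) ^ 2 / 2 := by
  have h := Real.hasSum_pow_div_log_of_abs_lt_one (x := 1 - r)
    (by rw [abs_lt]; constructor <;> linarith)
  have h2 := sum_le_hasSum (Finset.range 2) (fun i _ => by
    have : 0 ≤ 1 - r := by linarith
    positivity) h
  norm_num [Finset.sum_range_succ] at h2
  linarith

theorem measureReal_eq_tsum {ν : Measure ℕ} (hν0 : ν {0} = 0)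
    (hν : ∀ ℓ : ℕ, 1 ≤ ℓ → ν {ℓ} = (1 / 2 : ℝ≥0∞) ^ ℓ) (S : Set ℕ) [DecidablePred (· ∈ S)] :
    ν.real S = ∑' ℓ : ℕ, if ℓ + 1 ∈ S then (1 / 2 : ℝ) ^ (ℓ + 1) else 0 := by
  rw [measureReal_def, ← Measure.tsum_indicator_apply_singleton ν S (MeasurableSet.of_discrete),
    tsum_eq_zero_add' ENNReal.summable]
  have h0 : S.indicator (fun x => ν {x}) 0 = 0 := by
    by_cases h : 0 ∈ S <;> simp [h, hν0]
  rw [h0, zero_add]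
  have h1 : ∀ ℓ : ℕ, S.indicator (fun x => ν {x}) (ℓ + 1) =
      ENNReal.ofReal (if ℓ + 1 ∈ S then (1 / 2 : ℝ) ^ (ℓ + 1) else 0) := by
    intro ℓ
    by_cases h : ℓ + 1 ∈ S
    · rw [Set.indicator_of_mem h, if_pos h, hν _ (by omega), ENNReal.ofReal_pow (by norm_num),
        ENNReal.ofReal_div_of_pos (by norm_num)]
      simp
    · simp [h]
  simp only [h1]
  rw [ENNReal.tsum_toReal_eq (fun _ => ENNReal.ofReal_ne_top)]
  refine tsum_congr fun ℓ => ENNReal.toReal_ofReal ?_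
  split_ifs <;> positivity

theorem measureReal_Ici_succ {ν : Measure ℕ} [IsProbabilityMeasure ν] (hν0 : ν {0} = 0)
    (hν : ∀ ℓ : ℕ, 1 ≤ ℓ → ν {ℓ} = (1 / 2 : ℝ≥0∞) ^ ℓ) (J : ℕ) :
    ν.real (Set.Ici (J + 1)) = (1 / 2 : ℝ) ^ J := by
  have hsplit : ∀ m : ℕ, ν.real (Set.Ici m) = ν.real {m} + ν.real (Set.Ici (m + 1)) := by
    intro m
    rw [← measureReal_union (by simp) MeasurableSet.of_discrete]
    congr 1
    ext x
    simp only [Set.mem_Ici, Set.singleton_union, Set.mem_insert_iff]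
    omega
  induction J with
  | zero =>
    have h := hsplit 0
    rw [show (Set.Ici 0 : Set ℕ) = Set.univ by ext; simp, probReal_univ, measureReal_def, hν0] at h
    simpa using h.symm
  | succ J ih =>
    have h := hsplit (J + 1)
    rw [ih, measureReal_def, hν _ (by omega)] at h
    have h2 : ((1 / 2 : ℝ≥0∞) ^ (J + 1)).toReal = (1 / 2 : ℝ) ^ (J + 1) := by simp
    rw [h2] at h
    have h3 : (1 / 2 : ℝ) ^ (J + 1) = (1 / 2) ^ J / 2 := by ring
    linarith

theorem pVal_eq_measureReal {ν : Measure ℕ} (hν0 : ν {0} = 0)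
    (hν : ∀ ℓ : ℕ, 1 ≤ ℓ → ν {ℓ} = (1 / 2 : ℝ≥0∞) ^ ℓ) (n k : ℕ) (L : Fin n → ℕ) (m : ℕ) :
    pVal n k L m = ν.real {ℓ | levelCount n L ℓ m < k} := by
  classical
  rw [measureReal_eq_tsum hν0 hν, pVal]
  simp

theorem levelCount_mono {n : ℕ} (L : Fin n → ℕ) (ℓ : ℕ) {m m' : ℕ} (h : m ≤ m') :
    levelCount n L ℓ m ≤ levelCount n L ℓ m' :=
  Finset.card_le_card fun j hj => by
    simp only [Finset.mem_filter, Finset.mem_univ, true_and] at hj ⊢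
    exact ⟨hj.1.trans_le h, hj.2⟩

theorem levelCount_update {n : ℕ} (L : Fin n → ℕ) (ℓ m : ℕ) {j : Fin n} (h : m ≤ j) (x : ℕ) :
    levelCount n (Function.update L j x) ℓ m = levelCount n L ℓ m := by
  unfold levelCount
  congr 1
  refine Finset.filter_congr fun i _ => and_congr_right fun hi => ?_
  rw [Function.update_of_ne]
  rintro rfl
  omega

theorem pVal_update {n : ℕ} (k : ℕ) (L : Fin n → ℕ) (m : ℕ) {j : Fin n} (h : m ≤ j) (x : ℕ) :
    pVal n k (Function.update L j x) m = pVal n k L m := by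
  simp only [pVal, levelCount_update L _ m h]

/-- Chernoff bound for the number of the first `m` points whose level lies in `S`. -/
theorem measure_le_card_le {n : ℕ} (ν : Measure ℕ) [IsProbabilityMeasure ν] (S : Set ℕ)
    [DecidablePred (· ∈ S)] (m k : ℕ) {μ : ℝ} (hμ0 : 0 < μ) (hμk : μ ≤ k)
    (hμ : ((min m n : ℕ) : ℝ) * ν.real S ≤ μ) :
    (Measure.pi fun _ : Fin n => ν)
        {L | k ≤ (Finset.univ.filter fun j : Fin n => (j : ℕ) < m ∧ L j ∈ S).card} ≤
      ENNReal.ofReal (Real.exp (-((k - μ) ^ 2 / (2 * k)))) := by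
  have hk : (0 : ℝ) < k := hμ0.trans_le hμk
  set θ := Real.log (k / μ) with hθ
  have hθ0 : 0 ≤ θ := Real.log_nonneg (by rwa [one_le_div hμ0])
  have hexp : Real.exp θ = k / μ := Real.exp_log (by positivity)
  have hexp1 : 1 ≤ Real.exp θ := Real.one_le_exp hθ0
  have h := measure_le_sum_le (n := n) ν
    (fun i L => if (i : ℕ) < m then (if L i ∈ S then θ else 0) else 0)
    (fun i => if (i : ℕ) < m then (Real.exp θ - 1) * ν.real S else 0)
    (fun i j hij L x => by simp only [Function.update_of_ne hij.ne]) (fun i L => by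
      by_cases him : (i : ℕ) < m
      · simp only [him, if_true, Function.update_self]
        have e : ∀ x, Real.exp (if x ∈ S then θ else 0) = if x ∈ S then Real.exp θ else 1 := by
          intro x; split_ifs <;> simp
        simp only [e]
        rw [lintegral_ofReal_ite ν MeasurableSet.of_discrete (Real.exp_pos _).le zero_le_one]
        apply ENNReal.ofReal_le_ofReal
        refine le_trans (le_of_eq ?_) (Real.add_one_le_exp _)
        ring
      · simp [him]) (k * θ)
  refine (measure_mono ?_).trans (h.trans ?_)
  · intro L hL
    simp only [Set.mem_ofPred_eq] at hL ⊢
    have : (∑ i : Fin n, if (i : ℕ) < m then (if L i ∈ S then θ else 0) else 0) =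
        (Finset.univ.filter fun j : Fin n => (j : ℕ) < m ∧ L j ∈ S).card * θ := by
      simp only [← ite_and]
      rw [← Finset.sum_filter, Finset.sum_const, nsmul_eq_mul]
    rw [this]
    gcongr
  · apply ENNReal.ofReal_le_ofReal
    apply Real.exp_le_exp.2
    have hcard : (Finset.univ.filter fun j : Fin n => (j : ℕ) < m).card = min m n := by
      rw [Fin.card_filter_val_lt, min_comm]
    rw [← Finset.sum_filter, Finset.sum_const, hcard, nsmul_eq_mul]
    have h1 : ((min m n : ℕ) : ℝ) * ((Real.exp θ - 1) * ν.real S) ≤ k - μ := by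
      calc ((min m n : ℕ) : ℝ) * ((Real.exp θ - 1) * ν.real S)
          = (Real.exp θ - 1) * (((min m n : ℕ) : ℝ) * ν.real S) := by ring
        _ ≤ (Real.exp θ - 1) * μ := by gcongr
        _ = k - μ := by rw [hexp]; field_simp
    have h2 := log_le_sub_one_sub_sq (r := μ / k) (by positivity) (by rwa [div_le_one hk])
    have h3 : θ = -Real.log (μ / k) := by rw [hθ, ← Real.log_inv, inv_div]
    have h4 := mul_le_mul_of_nonneg_left h2 hk.le
    have h5 : (k : ℝ) * ((μ / k - 1) - (1 - μ / k) ^ 2 / 2) =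
        μ - k - (k - μ) ^ 2 / (2 * k) := by field_simp
    have h6 : (k : ℝ) * θ = -(k * Real.log (μ / k)) := by rw [h3]; ring
    linarith

theorem sum_range_two_pow_log_sub_one_le {B : ℕ} (hB : 0 < B) (m : ℕ) :
    ∑ i ∈ Finset.range m, ((2 : ℝ) ^ Nat.log 2 (i / B) - 1) ≤ 3 / (8 * B) * (m : ℝ) ^ 2 := by
  have hB' : (0 : ℝ) < B := by exact_mod_cast hB
  have key : ∀ m : ℕ, (m < B → ∑ i ∈ Finset.range m, ((2 : ℝ) ^ Nat.log 2 (i / B) - 1) ≤ 0) ∧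
      (B ≤ m → ∑ i ∈ Finset.range m, ((2 : ℝ) ^ Nat.log 2 (i / B) - 1) ≤
        2 ^ Nat.log 2 (m / B) * m - 2 / 3 * B * (2 ^ Nat.log 2 (m / B)) ^ 2) := by
    intro m
    induction m with
    | zero => exact ⟨fun _ => by simp, fun h => by omega⟩
    | succ m ih =>
      rw [Finset.sum_range_succ]
      rcases lt_or_ge m B with h | h
      · have h0 : m / B = 0 := Nat.div_eq_of_lt h
        have hW := ih.1 h
        simp only [h0, Nat.log_zero_right, pow_zero, sub_self, add_zero]
        refine ⟨fun _ => hW, fun h' => ?_⟩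
        obtain rfl : m + 1 = B := by omega
        rw [Nat.div_self hB]
        simp only [Nat.log_one_right, pow_zero]
        linarith
      · refine ⟨fun h' => by omega, fun _ => ?_⟩
        have hW := ih.2 h
        set J := Nat.log 2 (m / B) with hJ
        have hmB : m / B ≠ 0 := (Nat.div_pos h hB).ne'
        have hlt : m / B < 2 ^ (J + 1) := Nat.lt_pow_succ_log_self (by norm_num) _
        have hlt' : m < 2 ^ (J + 1) * B := (Nat.div_lt_iff_lt_mul hB).1 hlt
        rcases (Nat.succ_le_of_lt hlt').lt_or_eq with h1 | h1
        · have hJ' : Nat.log 2 ((m + 1) / B) = J := by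
            refine le_antisymm (Nat.lt_succ_iff.1 (Nat.log_lt_of_lt_pow ?_ ?_)) ?_
            · exact (Nat.div_pos (by omega) hB).ne'
            · exact (Nat.div_lt_iff_lt_mul hB).2 h1
            · exact Nat.log_mono_right (Nat.div_le_div_right (Nat.le_succ m))
          rw [hJ']
          push_cast
          linarith
        · have hJ' : Nat.log 2 ((m + 1) / B) = J + 1 := by
            rw [show m + 1 = 2 ^ (J + 1) * B from h1, Nat.mul_div_cancel _ hB,
              Nat.log_pow (by norm_num)]
          have h2 : ((m : ℝ) + 1) = 2 ^ (J + 1) * B := by exact_mod_cast h1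
          rw [hJ']
          push_cast
          have h3 : (m : ℝ) = 2 ^ (J + 1) * B - 1 := by linarith
          rw [h3] at hW ⊢
          rw [pow_succ] at *
          nlinarith
  rcases lt_or_ge m B with h | h
  · exact ((key m).1 h).trans (by positivity)
  · refine ((key m).2 h).trans ?_
    set y : ℝ := 2 ^ Nat.log 2 (m / B)
    have : 3 / (8 * B) * (m : ℝ) ^ 2 - (y * m - 2 / 3 * B * y ^ 2) =
        3 / (8 * B) * (m - 4 / 3 * (y * B)) ^ 2 := by
      field_simp
      ring
    have h2 : 0 ≤ 3 / (8 * (B : ℝ)) * (m - 4 / 3 * (y * B)) ^ 2 := by positivity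
    linarith

theorem nsmul_le_sum_range_of_antitone {g : ℕ → ℝ} (hg : Antitone g) (m : ℕ) :
    m * g m ≤ ∑ i ∈ Finset.range m, g i := by
  have h := Finset.card_nsmul_le_sum (Finset.range m) g (g m)
    fun i hi => hg (Finset.mem_range.1 hi).le
  simpa using h

/-- Abel-summation bound: quadratic growth of the partial sums of the weights controls the weighted
sum of squares of a nonincreasing sequence by the square of its sum. -/
theorem sum_sq_mul_le_of_antitone {g w : ℕ → ℝ} {c : ℝ} (hg : Antitone g) (hg0 : ∀ i, 0 ≤ g i)
    (hc : 0 ≤ c) (hw : ∀ m : ℕ, ∑ i ∈ Finset.range m, w i ≤ c * (m : ℝ) ^ 2) (m : ℕ) :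
    ∑ i ∈ Finset.range m, g i ^ 2 * w i ≤ c * (∑ i ∈ Finset.range m, g i) ^ 2 := by
  have key : ∀ m : ℕ, g m ^ 2 * (c * (m : ℝ) ^ 2 - ∑ i ∈ Finset.range m, w i) ≤
      c * (∑ i ∈ Finset.range m, g i) ^ 2 - ∑ i ∈ Finset.range m, g i ^ 2 * w i := by
    intro m
    induction m with
    | zero => simp
    | succ m ih =>
      have h1 : g (m + 1) ^ 2 ≤ g m ^ 2 := pow_le_pow_left₀ (hg0 _) (hg (Nat.le_succ m)) 2
      have h2 := mul_le_mul_of_nonneg_right h1 (sub_nonneg.2 (hw (m + 1)))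
      refine h2.trans ?_
      have h3 := mul_le_mul_of_nonneg_left
        (mul_le_mul_of_nonneg_right (nsmul_le_sum_range_of_antitone hg m) (hg0 m)) hc
      simp only [Finset.sum_range_succ]
      push_cast
      linear_combination ih + 2 * h3
  have := key m
  have h2 := mul_nonneg (sq_nonneg (g m)) (sub_nonneg.2 (hw m))
  linarith

theorem measure_sum_increments_ge_le {n k : ℕ} {ν : Measure ℕ} [IsProbabilityMeasure ν]
    (hν0 : ν {0} = 0) (hν : ∀ ℓ : ℕ, 1 ≤ ℓ → ν {ℓ} = (1 / 2 : ℝ≥0∞) ^ ℓ)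
    {f q : Fin n → ℝ} (hf : ∀ i, 0 ≤ f i) (hq0 : ∀ i, 0 < q i) (hq1 : ∀ i, q i ≤ 1)
    {M V x : ℝ} (hM : 0 ≤ M) (hV : 0 < V) (hx : 0 < x) (hqM : ∀ i, q i < 1 → f i / q i ≤ M)
    (hqV : ∑ i, f i ^ 2 * (1 / q i - 1) ≤ V) {ε : ℝ} (hε : |ε| = 1) :
    (Measure.pi fun _ : Fin n => ν) {L | Real.sqrt (2 * V * x) + 2 * M * x / 3 ≤
        ∑ i, if q i ≤ pVal n k L i then ε * ((IVal n k L i / pVal n k L i - 1) * f i) else 0} ≤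
      ENNReal.ofReal (Real.exp (-x)) := by
  classical
  obtain ⟨θ, hθ0, hθM, hθ⟩ := bernstein_exponent_le hV hM hx
  set D := θ ^ 2 / (2 * (1 - θ * M / 3)) with hD
  have hD0 : 0 ≤ D := div_nonneg (sq_nonneg _) (by linarith)
  set t := Real.sqrt (2 * V * x) + 2 * M * x / 3 with ht
  have hε2 : ε ^ 2 = 1 := by rw [← sq_abs, hε, one_pow]
  have hv0 : ∀ i, 0 ≤ f i ^ 2 * (1 / q i - 1) := fun i =>
    mul_nonneg (sq_nonneg _) (sub_nonneg.2 (by rw [le_div_iff₀ (hq0 i)]; linarith [hq1 i]))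
  have h := measure_le_sum_le (n := n) ν
    (fun i L => θ * if q i ≤ pVal n k L i then
      ε * ((IVal n k L i / pVal n k L i - 1) * f i) else 0)
    (fun i => f i ^ 2 * (1 / q i - 1) * D) ?_ ?_ (θ * t)
  · refine (measure_mono ?_).trans (h.trans ?_)
    · intro L hL
      simp only [Set.mem_ofPred_eq] at hL ⊢
      rw [← Finset.mul_sum]
      exact mul_le_mul_of_nonneg_left hL hθ0
    · apply ENNReal.ofReal_le_ofReal
      apply Real.exp_le_exp.2
      rw [← Finset.sum_mul]
      have := mul_le_mul_of_nonneg_right hqV hD0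
      linarith
  · intro i j hij L y
    have hij' : (i : ℕ) ≤ j := hij.le
    simp only [pVal_update k L i hij', IVal, levelCount_update L _ i hij',
      Function.update_of_ne hij.ne]
  · intro i L
    simp only [pVal_update k L i le_rfl, IVal, levelCount_update L _ i le_rfl,
      Function.update_self]
    by_cases hqp : q i ≤ pVal n k L i
    swap
    · simp only [hqp, if_false, mul_zero, Real.exp_zero, lintegral_const, measure_univ, mul_one]
      exact ENNReal.ofReal_le_ofReal (Real.one_le_exp (mul_nonneg (hv0 i) hD0))
    simp only [hqp, if_true]
    set p := pVal n k L i with hp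
    set O : Set ℕ := {ℓ | levelCount n L ℓ i < k} with hO
    have hpO : ν.real O = p := (pVal_eq_measureReal hν0 hν n k L i).symm
    have hp0 : 0 < p := (hq0 i).trans_le hqp
    have hp1 : p ≤ 1 := hpO ▸ measureReal_le_one
    have e : ∀ y, Real.exp (θ * (ε * (((if levelCount n L y i < k then (1 : ℝ) else 0) / p - 1) *
        f i))) = if y ∈ O then Real.exp (θ * (ε * ((1 / p - 1) * f i))) else
          Real.exp (θ * (ε * (-1 * f i))) := by
      intro y
      by_cases hy : levelCount n L y i < k <;> simp [hO, hy]
    simp only [e]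
    rw [lintegral_ofReal_ite ν MeasurableSet.of_discrete (Real.exp_pos _).le (Real.exp_pos _).le,
      hpO]
    apply ENNReal.ofReal_le_ofReal
    rcases hp1.lt_or_eq with hlt | heq
    · have hfM : f i / q i ≤ M := hqM i (hqp.trans_lt hlt)
      have hfp : f i / p ≤ M :=
        (div_le_div_of_nonneg_left (hf i) (hq0 i) hqp).trans hfM
      have hfM' : f i ≤ M := le_trans (by rw [le_div_iff₀ hp0]; nlinarith [hf i]) hfp
      have hbd : ∀ z, |z| ≤ M → ε * z ≤ M := fun z hz =>
        (le_abs_self _).trans (by rw [abs_mul, hε, one_mul]; exact hz)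
      have h1p : 0 ≤ 1 / p - 1 := sub_nonneg.2 (by rw [le_div_iff₀ hp0]; linarith)
      refine bernstein_mgf_two_point hp0.le hp1 ?_ (hbd _ ?_) (hbd _ ?_) hM ?_ hθ0 hθM
      · field_simp
        ring
      · rw [abs_of_nonneg (mul_nonneg h1p (hf i))]
        have : (1 / p - 1) * f i = f i / p - f i := by ring
        linarith [hf i]
      · rw [abs_mul, abs_of_nonneg (hf i)]
        simpa using hfM'
      · have h1 : p * (ε * ((1 / p - 1) * f i)) ^ 2 + (1 - p) * (ε * (-1 * f i)) ^ 2 =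
            ε ^ 2 * (f i ^ 2 * (1 / p - 1)) := by
          field_simp
          ring
        rw [h1, hε2, one_mul]
        gcongr
        exact hq0 i
    · rw [heq]
      simp only [div_one, sub_self, zero_mul, mul_zero, Real.exp_zero, mul_one, add_zero]
      exact Real.one_le_exp (mul_nonneg (hv0 i) hD0)

/-- With high probability no level `ℓ ≥ 1` is full before time `B * 2 ^ ℓ`. -/
theorem measure_exists_level_full_le {n k B N : ℕ} {ν : Measure ℕ} [IsProbabilityMeasure ν]
    (hν0 : ν {0} = 0) (hν : ∀ ℓ : ℕ, 1 ≤ ℓ → ν {ℓ} = (1 / 2 : ℝ≥0∞) ^ ℓ)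
    (hk : 0 < k) (hB : 0 < B) (hN : n ≤ k * 2 ^ (N + 1)) {Λ : ℝ} (hΛ : 0 ≤ Λ)
    (hs : Real.sqrt (2 * k * Λ) ≤ k / 2) (hBs : (B : ℝ) ≤ k - Real.sqrt (2 * k * Λ)) :
    (Measure.pi fun _ : Fin n => ν)
        {L | ∃ ℓ, 1 ≤ ℓ ∧ ∃ m, m ≤ B * 2 ^ ℓ ∧ k ≤ levelCount n L ℓ m} ≤
      ENNReal.ofReal ((N + 3) * Real.exp (-Λ)) := by
  classical
  have hk' : (0 : ℝ) < k := by exact_mod_cast hk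
  have hB' : (0 : ℝ) < B := by exact_mod_cast hB
  have hs0 := Real.sqrt_nonneg (2 * k * Λ)
  have hs2 : Real.sqrt (2 * k * Λ) ^ 2 = 2 * k * Λ := Real.sq_sqrt (by positivity)
  have hexp : ∀ μ : ℝ, μ ≤ k - Real.sqrt (2 * k * Λ) →
      ENNReal.ofReal (Real.exp (-((k - μ) ^ 2 / (2 * k)))) ≤
        ENNReal.ofReal (Real.exp (-Λ)) := by
    intro μ hμ
    apply ENNReal.ofReal_le_ofReal
    rw [Real.exp_le_exp, neg_le_neg_iff, le_div_iff₀ (by positivity)]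
    nlinarith
  set P := Measure.pi fun _ : Fin n => ν with hP
  set A : ℕ → Set (Fin n → ℕ) := fun ℓ => {L | k ≤ levelCount n L ℓ (B * 2 ^ ℓ)} with hA
  set T : Set (Fin n → ℕ) := {L | k ≤ (Finset.univ.filter fun j : Fin n =>
    (j : ℕ) < n ∧ L j ∈ Set.Ici (N + 2 + 1)).card} with hT
  have hsub : {L | ∃ ℓ, 1 ≤ ℓ ∧ ∃ m, m ≤ B * 2 ^ ℓ ∧ k ≤ levelCount n L ℓ m} ⊆
      (⋃ ℓ ∈ Finset.Icc 1 (N + 2), A ℓ) ∪ T := by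
    rintro L ⟨ℓ, hℓ, m, hm, hkm⟩
    by_cases h : ℓ ≤ N + 2
    · left
      simp only [Set.mem_iUnion]
      exact ⟨ℓ, Finset.mem_Icc.2 ⟨hℓ, h⟩, hkm.trans (levelCount_mono L ℓ hm)⟩
    · right
      refine hkm.trans (Finset.card_le_card fun j hj => ?_)
      simp only [Finset.mem_filter, Finset.mem_univ, true_and, Set.mem_Ici] at hj ⊢
      exact ⟨j.2, by omega⟩
  have hAle : ∀ ℓ ∈ Finset.Icc 1 (N + 2), P (A ℓ) ≤ ENNReal.ofReal (Real.exp (-Λ)) := by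
    intro ℓ hℓ
    refine le_trans ?_ (hexp B hBs)
    refine le_trans (le_of_eq ?_) (measure_le_card_le (n := n) ν {ℓ} (B * 2 ^ ℓ) k hB' (by linarith) ?_)
    · simp [hA, levelCount, hP]
    · rw [measureReal_def, hν ℓ (Finset.mem_Icc.1 hℓ).1]
      have h1 : ((1 / 2 : ℝ≥0∞) ^ ℓ).toReal = 1 / (2 : ℝ) ^ ℓ := by simp
      have h2 : ((min (B * 2 ^ ℓ) n : ℕ) : ℝ) ≤ B * 2 ^ ℓ := by
        exact_mod_cast min_le_left _ _
      rw [h1, mul_one_div, div_le_iff₀ (by positivity)]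
      exact h2
  have hTle : P T ≤ ENNReal.ofReal (Real.exp (-Λ)) := by
    refine le_trans ?_ (hexp (k / 2) (by linarith))
    refine measure_le_card_le ν (Set.Ici (N + 2 + 1)) n k (by positivity) (by linarith) ?_
    rw [measureReal_Ici_succ hν0 hν, min_self, one_div, inv_pow, ← div_eq_mul_inv,
      div_le_iff₀ (by positivity)]
    have : (n : ℝ) ≤ k * 2 ^ (N + 1) := by exact_mod_cast hN
    rw [pow_succ]
    linarith
  calc P _ ≤ P ((⋃ ℓ ∈ Finset.Icc 1 (N + 2), A ℓ) ∪ T) := measure_mono hsub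
    _ ≤ (∑ ℓ ∈ Finset.Icc 1 (N + 2), P (A ℓ)) + P T :=
        (measure_union_le _ _).trans (by gcongr; exact measure_biUnion_finset_le _ _)
    _ ≤ (∑ ℓ ∈ Finset.Icc 1 (N + 2), ENNReal.ofReal (Real.exp (-Λ))) +
          ENNReal.ofReal (Real.exp (-Λ)) := by gcongr with ℓ hℓ; exact hAle ℓ hℓ
    _ = ENNReal.ofReal ((N + 3) * Real.exp (-Λ)) := by
        rw [Finset.sum_const, Nat.card_Icc, nsmul_eq_mul, ← ENNReal.ofReal_natCast,
          ← ENNReal.ofReal_mul (by positivity), ← ENNReal.ofReal_add (by positivity)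
          (by positivity)]
        congr 1
        push_cast
        ring

theorem half_pow_log_le_pVal {n k B : ℕ} {ν : Measure ℕ} [IsProbabilityMeasure ν]
    (hν0 : ν {0} = 0) (hν : ∀ ℓ : ℕ, 1 ≤ ℓ → ν {ℓ} = (1 / 2 : ℝ≥0∞) ^ ℓ) (hB : 0 < B)
    {L : Fin n → ℕ} (hL : ∀ ℓ, 1 ≤ ℓ → ∀ m, m ≤ B * 2 ^ ℓ → levelCount n L ℓ m < k) (m : ℕ) :
    (1 / 2 : ℝ) ^ Nat.log 2 (m / B) ≤ pVal n k L m := by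
  rw [pVal_eq_measureReal hν0 hν, ← measureReal_Ici_succ hν0 hν]
  refine measureReal_mono fun ℓ hℓ => hL ℓ (by simp at hℓ; omega) m ?_
  have h1 : m / B < 2 ^ (Nat.log 2 (m / B) + 1) := Nat.lt_pow_succ_log_self (by norm_num) _
  have h2 := (Nat.div_lt_iff_lt_mul hB).1 h1
  calc m ≤ 2 ^ (Nat.log 2 (m / B) + 1) * B := h2.le
    _ ≤ 2 ^ ℓ * B := by gcongr; norm_num; exact hℓ
    _ = B * 2 ^ ℓ := mul_comm _ _

section Deterministic

variable {n B : ℕ} {f : Fin n → ℝ}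

theorem div_half_pow_log_le (hB : 0 < B) (hmono : ∀ i j : Fin n, i ≤ j → f j ≤ f i)
    (hf : ∀ i, 0 ≤ f i) (i : Fin n) (hi : (1 / 2 : ℝ) ^ Nat.log 2 ((i : ℕ) / B) < 1) :
    f i / (1 / 2 : ℝ) ^ Nat.log 2 ((i : ℕ) / B) ≤ (∑ j, f j) / B := by
  have hB' : (0 : ℝ) < B := by exact_mod_cast hB
  have hne : (i : ℕ) / B ≠ 0 := fun h => by simp [h] at hi
  have h1 : 2 ^ Nat.log 2 ((i : ℕ) / B) * B ≤ (i : ℕ) :=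
    (Nat.le_div_iff_mul_le hB).1 (Nat.pow_log_le_self 2 hne)
  have h2 : (2 : ℝ) ^ Nat.log 2 ((i : ℕ) / B) * B ≤ (i : ℕ) := by exact_mod_cast h1
  have h3 : ((i : ℕ) : ℝ) * f i ≤ ∑ j, f j := by
    calc ((i : ℕ) : ℝ) * f i = ∑ j ∈ Finset.Iio i, f i := by simp
      _ ≤ ∑ j ∈ Finset.Iio i, f j := Finset.sum_le_sum fun j hj =>
          hmono j i (Finset.mem_Iio.1 hj).le
      _ ≤ ∑ j, f j := Finset.sum_le_sum_of_subset_of_nonneg (Finset.subset_univ _)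
          fun j _ _ => hf j
  rw [le_div_iff₀ hB', one_div, inv_pow, div_inv_eq_mul]
  nlinarith [mul_le_mul_of_nonneg_right h2 (hf i)]

theorem sum_sq_mul_half_pow_log_le (hB : 0 < B) (hmono : ∀ i j : Fin n, i ≤ j → f j ≤ f i)
    (hf : ∀ i, 0 ≤ f i) :
    ∑ i, f i ^ 2 * (1 / (1 / 2 : ℝ) ^ Nat.log 2 ((i : ℕ) / B) - 1) ≤
      3 / (8 * B) * (∑ i, f i) ^ 2 := by
  set g : ℕ → ℝ := fun i => if h : i < n then f ⟨i, h⟩ else 0 with hg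
  have hgf : ∀ i : Fin n, g i = f i := fun i => by simp [hg]
  have hg0 : ∀ i, 0 ≤ g i := fun i => by
    simp only [hg]
    split_ifs
    exacts [hf _, le_rfl]
  have hanti : Antitone g := fun i j hij => by
    by_cases hj : j < n
    · simpa [hg, hj, hij.trans_lt hj] using hmono ⟨i, hij.trans_lt hj⟩ ⟨j, hj⟩ hij
    · simpa [hg, hj] using hg0 i
  have h := sum_sq_mul_le_of_antitone (c := 3 / (8 * B)) hanti hg0 (by positivity)
    (sum_range_two_pow_log_sub_one_le hB) n
  rw [Finset.sum_range, Finset.sum_range] at h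
  simpa [hgf] using h

end Deterministic

/-- (Main theorem.) Let `n, k` be positive integers with `k ≤ n`, let
`δ ∈ (0,1)`, set `ℓ* = ⌊log₂(n/k)⌋`, assume `k ≥ 8·log(3(ℓ*+3)/δ)`, and set
`b = k − ⌈√(2k·log(3(ℓ*+3)/δ))⌉`. Let `f_1 ≥ … ≥ f_n ≥ 0` with `F = ∑ f_i > 0`, and let
`E = ∑ (I_i/p_i)·f_i` be the estimator built from levels `ℓ_i` independently distributed
as `Pr(ℓ_i = ℓ) = 2^{−ℓ}` (encoded by the product measure `Measure.pi (fun _ => ν)` of a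
probability measure `ν` on `ℕ` with `ν {0} = 0` and `ν {ℓ} = 2^{−ℓ}` for `ℓ ≥ 1`).
Then with probability at least `1 − δ` over the random levels,
`|E − F|/F ≤ √(3·log(3/δ)/(4b)) + 2·log(3/δ)/(3b)`. -/
theorem stmt_3 (n k : ℕ) (hn : 0 < n) (hk : 0 < k) (hkn : k ≤ n)
    (δ : ℝ) (hδ : δ ∈ Set.Ioo (0 : ℝ) 1)
    (lstar : ℤ) (hlstar : lstar = ⌊Real.logb 2 ((n : ℝ) / (k : ℝ))⌋)
    (hk8 : 8 * Real.log (3 * ((lstar : ℝ) + 3) / δ) ≤ (k : ℝ))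
    (b : ℝ)
    (hb : b = (k : ℝ) - (⌈Real.sqrt (2 * (k : ℝ) * Real.log (3 * ((lstar : ℝ) + 3) / δ))⌉ : ℝ))
    (f : Fin n → ℝ) (hmono : ∀ i j : Fin n, i ≤ j → f j ≤ f i) (hf : ∀ i, 0 ≤ f i)
    (hF : 0 < ∑ i, f i)
    (ν : Measure ℕ) [IsProbabilityMeasure ν] (hν0 : ν {0} = 0)
    (hν : ∀ ℓ : ℕ, 1 ≤ ℓ → ν {ℓ} = (1 / 2 : ℝ≥0∞) ^ ℓ) :
    ENNReal.ofReal (1 - δ) ≤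
      (Measure.pi fun _ : Fin n => ν)
        {L : Fin n → ℕ |
          |(∑ i : Fin n, IVal n k L i / pVal n k L (i : ℕ) * f i) - ∑ i, f i| / (∑ i, f i)
            ≤ Real.sqrt (3 * Real.log (3 / δ) / (4 * b)) +
                2 * Real.log (3 / δ) / (3 * b)} := by
  classical
  obtain ⟨hδ0, hδ1⟩ := hδ
  have hk' : (0 : ℝ) < k := by exact_mod_cast hk
  have hnk : (1 : ℝ) ≤ n / k := by rw [one_le_div hk']; exact_mod_cast hkn
  have hlstar0 : 0 ≤ lstar := hlstar ▸ Int.floor_nonneg.2 (Real.logb_nonneg (by norm_num) hnk)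
  obtain ⟨N, rfl⟩ := Int.eq_ofNat_of_zero_le hlstar0
  rw [Int.cast_natCast] at hk8 hb
  have hN : n ≤ k * 2 ^ (N + 1) := by
    have h1 := Int.lt_floor_add_one (Real.logb 2 ((n : ℝ) / k))
    rw [← hlstar, Int.cast_natCast, Real.logb_lt_iff_lt_rpow (by norm_num) (by positivity)] at h1
    have h2 : (n : ℝ) / k < 2 ^ (N + 1) := by exact_mod_cast h1
    rw [div_lt_iff₀ hk'] at h2
    have h3 : (n : ℝ) < k * 2 ^ (N + 1) := by linarith
    exact_mod_cast h3.le
  set Λ := Real.log (3 * ((N : ℝ) + 3) / δ) with hΛ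
  have harg : 3 ≤ 3 * ((N : ℝ) + 3) / δ := by
    rw [le_div_iff₀ hδ0]
    nlinarith [(Nat.cast_nonneg N : (0 : ℝ) ≤ N)]
  have hΛ1 : 1 ≤ Λ := by
    rw [hΛ, Real.le_log_iff_exp_le (by linarith)]
    linarith [Real.exp_one_lt_d9]
  have hexpΛ : Real.exp (-Λ) = δ / (3 * ((N : ℝ) + 3)) := by
    rw [Real.exp_neg, hΛ, Real.exp_log (by linarith), inv_div]
  set s := Real.sqrt (2 * k * Λ) with hs
  have hsk : s ≤ k / 2 := by
    rw [hs, Real.sqrt_le_left (by positivity)]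
    nlinarith
  have hb0 : 0 < b := by
    have := Int.ceil_lt_add_one s
    linarith
  obtain ⟨B, hBb⟩ : ∃ B : ℕ, (B : ℝ) = b := by
    have h1 : (0 : ℤ) ≤ (k : ℤ) - ⌈s⌉ := by
      have : (0 : ℝ) ≤ (((k : ℤ) - ⌈s⌉ : ℤ) : ℝ) := by push_cast; linarith
      exact_mod_cast this
    refine ⟨((k : ℤ) - ⌈s⌉).toNat, ?_⟩
    have h2 : ((((k : ℤ) - ⌈s⌉).toNat : ℤ) : ℝ) = (((k : ℤ) - ⌈s⌉ : ℤ) : ℝ) := by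
      rw [Int.toNat_of_nonneg h1]
    rw [hb]
    push_cast at h2 ⊢
    exact h2
  have hB : 0 < B := by exact_mod_cast hBb ▸ hb0
  have hBs : (B : ℝ) ≤ k - s := by
    have := Int.le_ceil s
    linarith
  clear hb
  subst hBb
  set F := ∑ i, f i with hFdef
  set x := Real.log (3 / δ) with hx
  have hx0 : 0 < x := Real.log_pos (by rw [one_lt_div hδ0]; linarith)
  have hexpx : Real.exp (-x) = δ / 3 := by
    rw [Real.exp_neg, hx, Real.exp_log (by positivity), inv_div]
  set q : Fin n → ℝ := fun i => (1 / 2 : ℝ) ^ Nat.log 2 ((i : ℕ) / B) with hq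
  set V := 3 / (8 * (B : ℝ)) * F ^ 2 with hV
  set M := F / B with hM
  have htail : ∀ ε : ℝ, |ε| = 1 → _ := fun ε hε =>
    measure_sum_increments_ge_le (k := k) (q := q) (M := M) (V := V) hν0 hν hf
      (fun i => by positivity) (fun i => pow_le_one₀ (by norm_num) (by norm_num))
      (by positivity) (by positivity) hx0 (div_half_pow_log_le hB hmono hf)
      (sum_sq_mul_half_pow_log_le hB hmono hf) hε
  have hfull := measure_exists_level_full_le (n := n) hν0 hν hk hB hN (by linarith) hsk hBs
  rw [hexpx] at htail
  rw [hexpΛ, show ((N : ℝ) + 3) * (δ / (3 * ((N : ℝ) + 3))) = δ / 3 by field_simp] at hfull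
  set P := Measure.pi fun _ : Fin n => ν with hP
  have ht : Real.sqrt (2 * V * x) + 2 * M * x / 3 =
      (Real.sqrt (3 * x / (4 * B)) + 2 * x / (3 * B)) * F := by
    have h1 : 2 * V * x = 3 * x / (4 * B) * F ^ 2 := by
      rw [hV]
      field_simp
      ring
    rw [h1, Real.sqrt_mul (by positivity), Real.sqrt_sq hF.le, hM]
    field_simp
  set t := Real.sqrt (2 * V * x) + 2 * M * x / 3 with ht_def
  set bad : ℝ → Set (Fin n → ℕ) := fun ε => {L | t ≤ ∑ i, if q i ≤ pVal n k L i then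
    ε * ((IVal n k L i / pVal n k L i - 1) * f i) else 0} with hbad
  set full : Set (Fin n → ℕ) :=
    {L | ∃ ℓ, 1 ≤ ℓ ∧ ∃ m, m ≤ B * 2 ^ ℓ ∧ k ≤ levelCount n L ℓ m} with hfull_def
  have hPbad : P (full ∪ (bad 1 ∪ bad (-1))) ≤ ENNReal.ofReal δ := by
    calc P (full ∪ (bad 1 ∪ bad (-1)))
        ≤ P full + (P (bad 1) + P (bad (-1))) :=
          (measure_union_le _ _).trans (by gcongr; exact measure_union_le _ _)
      _ ≤ ENNReal.ofReal (δ / 3) + (ENNReal.ofReal (δ / 3) + ENNReal.ofReal (δ / 3)) := by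
          gcongr
          · exact htail 1 (by simp)
          · exact htail (-1) (by simp)
      _ = ENNReal.ofReal δ := by
          rw [← ENNReal.ofReal_add (by positivity) (by positivity),
            ← ENNReal.ofReal_add (by positivity) (by positivity)]
          congr 1
          ring
  have hcompl : ENNReal.ofReal (1 - δ) ≤ P (full ∪ (bad 1 ∪ bad (-1)))ᶜ := by
    rw [prob_compl_eq_one_sub MeasurableSet.of_discrete, ENNReal.ofReal_sub _ hδ0.le,
      ENNReal.ofReal_one]
    gcongr
  refine hcompl.trans (measure_mono fun L hL => ?_)
  simp only [Set.mem_compl_iff, Set.mem_union, not_or] at hL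
  obtain ⟨hL1, hL2, hL3⟩ := hL
  have hgood : ∀ ℓ, 1 ≤ ℓ → ∀ m, m ≤ B * 2 ^ ℓ → levelCount n L ℓ m < k := by
    intro ℓ hℓ m hm
    by_contra h
    exact hL1 ⟨ℓ, hℓ, m, hm, not_lt.1 h⟩
  have hqp : ∀ i : Fin n, q i ≤ pVal n k L i := fun i =>
    half_pow_log_le_pVal hν0 hν hB hgood i
  have hsum : ∀ ε : ℝ, (∑ i, if q i ≤ pVal n k L i then
      ε * ((IVal n k L i / pVal n k L i - 1) * f i) else 0) =
        ε * ((∑ i, IVal n k L i / pVal n k L i * f i) - F) := by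
    intro ε
    simp only [hqp, if_true]
    rw [← Finset.mul_sum, hFdef, ← Finset.sum_sub_distrib]
    simp only [sub_mul, one_mul]
  simp only [hbad, Set.mem_ofPred_eq, hsum, not_le] at hL2 hL3
  rw [Set.mem_ofPred_eq, div_le_iff₀ hF, ← ht, abs_le]
  constructor <;> linarith
end

section
/- Let δ ∈ (0,1) and let k be a positive integer with k ≥ 8·log(1/δ); set b = k − ⌈√(2k·log(1/δ))⌉. With levels ℓ_1,…,ℓ_n independently distributed as Pr(ℓ_i = ℓ) = 2^{-ℓ}, for every fixed level ℓ ≥ 1 it holds that Pr(C_{ℓ, min(2^ℓ·b, n)} ≥ k) ≤ δ. -/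
open MeasureTheory
open scoped ENNReal

/-- Product form of Fubini for nonnegative functions of one coordinate each, under a finite power of
a probability measure. -/
lemma lintegral_pi_prod_eval {ι α : Type*} [Fintype ι] [MeasurableSpace α] (ν : Measure α)
    [IsProbabilityMeasure ν] (f : ι → α → ℝ≥0∞) (hf : ∀ i, Measurable (f i)) :
    ∫⁻ x, ∏ i, f i (x i) ∂(Measure.pi fun _ : ι => ν) = ∏ i, ∫⁻ a, f i a ∂ν := by
  have hind : ProbabilityTheory.iIndepFun (fun i (x : ι → α) => f i (x i))
      (Measure.pi fun _ : ι => ν) :=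
    ProbabilityTheory.iIndepFun_pi fun i => (hf i).aemeasurable
  rw [ProbabilityTheory.lintegral_prod_eq_prod_lintegral_of_indepFun Finset.univ _ hind
    fun i => (hf i).comp (measurable_pi_apply i)]
  exact Finset.prod_congr rfl fun i _ =>
    (measurePreserving_eval (fun _ : ι => ν) i).lintegral_comp (hf i)

/-- The moment generating function of `levelCount n · ℓ m`, evaluated at `1 + u`. -/
lemma lintegral_one_add_pow_levelCount (n : ℕ) (ν : Measure ℕ) [IsProbabilityMeasure ν]
    (ℓ m : ℕ) (u : ℝ≥0∞) :
    ∫⁻ L, (1 + u) ^ levelCount n L ℓ m ∂(Measure.pi fun _ : Fin n => ν)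
      = (1 + u * ν {ℓ}) ^ (Finset.univ.filter fun j : Fin n => (j : ℕ) < m).card := by
  have hpow : ∀ L : Fin n → ℕ, (1 + u) ^ levelCount n L ℓ m =
      ∏ j : Fin n, (if (j : ℕ) < m then 1 + Set.indicator {ℓ} (fun _ => u) (L j) else 1) := by
    intro L
    rw [levelCount, ← Finset.prod_const, Finset.prod_filter]
    refine Finset.prod_congr rfl fun j _ => ?_
    by_cases h1 : (j : ℕ) < m <;> by_cases h2 : L j = ℓ <;> simp [h1, h2]
  simp_rw [hpow]
  rw [lintegral_pi_prod_eval ν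
    (fun (j : Fin n) a => if (j : ℕ) < m then 1 + Set.indicator {ℓ} (fun _ => u) a else 1)
    fun j => measurable_from_nat, ← Finset.prod_const, Finset.prod_filter]
  refine Finset.prod_congr rfl fun j _ => ?_
  split_ifs
  · rw [lintegral_add_left measurable_const, lintegral_indicator (measurableSet_singleton ℓ)]
    simp
  · simp

/-- Chernoff bound for `levelCount`, before optimizing the parameter `r = 1 + u`. -/
lemma measure_le_levelCount_le (n k : ℕ) (ν : Measure ℕ) [IsProbabilityMeasure ν] (ℓ m : ℕ)
    {p u : ℝ} (hp : 0 ≤ p) (hu : 0 ≤ u) (hν : ν {ℓ} = ENNReal.ofReal p) :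
    (Measure.pi fun _ : Fin n => ν) {L | k ≤ levelCount n L ℓ m}
      ≤ ENNReal.ofReal (Real.exp (m * p * u - k * Real.log (1 + u))) := by
  set c := (Finset.univ.filter fun j : Fin n => (j : ℕ) < m).card
  have hc : c ≤ m := by
    have h : c ≤ (Finset.range m).card :=
      Finset.card_le_card_of_injOn (fun j : Fin n => (j : ℕ)) (fun j hj => by simpa using hj)
        fun a _ b _ h => Fin.ext h
    simpa using h
  have hone : (1 : ℝ≥0∞) + ENNReal.ofReal u = ENNReal.ofReal (1 + u) := by
    rw [ENNReal.ofReal_add zero_le_one hu, ENNReal.ofReal_one]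
  have hpos : (0 : ℝ) < (1 + u) ^ k := by positivity
  calc (Measure.pi fun _ : Fin n => ν) {L | k ≤ levelCount n L ℓ m}
      ≤ (Measure.pi fun _ : Fin n => ν)
          {L | (1 + ENNReal.ofReal u) ^ k ≤ (1 + ENNReal.ofReal u) ^ levelCount n L ℓ m} :=
        by
        gcongr
        intro h
        exact pow_le_pow_right₀ le_self_add h
    _ ≤ (1 + ENNReal.ofReal u * ν {ℓ}) ^ c / (1 + ENNReal.ofReal u) ^ k := by
        rw [← lintegral_one_add_pow_levelCount]
        refine meas_ge_le_lintegral_div (measurable_of_countable _).aemeasurable ?_ ?_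
        · exact pow_ne_zero _ (by simp)
        · exact ENNReal.pow_ne_top (by simp)
    _ = ENNReal.ofReal ((1 + u * p) ^ c / (1 + u) ^ k) := by
        rw [ENNReal.ofReal_div_of_pos hpos, ENNReal.ofReal_pow (by positivity),
          ENNReal.ofReal_pow (by positivity), hone, hν, ← ENNReal.ofReal_mul hu,
          ENNReal.ofReal_add (q := u * p) zero_le_one (by positivity), ENNReal.ofReal_one]
    _ ≤ ENNReal.ofReal (Real.exp (m * p * u - k * Real.log (1 + u))) := by
        refine ENNReal.ofReal_le_ofReal ?_
        rw [Real.exp_sub, Real.exp_nat_mul (Real.log _), Real.exp_log (by positivity)]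
        gcongr
        calc (1 + u * p) ^ c ≤ (1 + u * p) ^ m :=
              pow_le_pow_right₀ (by nlinarith [mul_nonneg hu hp]) hc
          _ ≤ Real.exp (u * p) ^ m := by
              gcongr
              linarith [Real.add_one_le_exp (u * p)]
          _ = Real.exp (m * p * u) := by
              rw [← Real.exp_nat_mul]
              ring_nf

lemma Real.add_sq_div_two_le_neg_log_one_sub {x : ℝ} (h0 : 0 ≤ x) (h1 : x < 1) :
    x + x ^ 2 / 2 ≤ -Real.log (1 - x) := by
  have h := Real.hasSum_pow_div_log_of_abs_lt_one (x := x) (by rwa [abs_of_nonneg h0])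
  have := sum_le_hasSum (Finset.range 2) (fun i _ => by positivity) h
  norm_num [Finset.sum_range_succ] at this
  linarith

/-- Let `δ ∈ (0,1)` and let `k` be a positive integer with
`k ≥ 8·log(1/δ)`; set `b = k − ⌈√(2k·log(1/δ))⌉` (an integer). With levels `ℓ_1,…,ℓ_n`
independently distributed as `Pr(ℓ_i = ℓ) = 2^{−ℓ}` (encoded by the product measure
`Measure.pi (fun _ => ν)` of a probability measure `ν` on `ℕ` with `ν {0} = 0` and
`ν {ℓ} = 2^{−ℓ}` for `ℓ ≥ 1`), for every fixed level `ℓ ≥ 1` it holds that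
`Pr(C_{ℓ, min(2^ℓ·b, n)} ≥ k) ≤ δ`. -/
theorem stmt_6 (n k : ℕ) (hk : 0 < k)
    (δ : ℝ) (hδ : δ ∈ Set.Ioo (0 : ℝ) 1)
    (h8 : 8 * Real.log (1 / δ) ≤ (k : ℝ))
    (b : ℤ) (hb : b = (k : ℤ) - ⌈Real.sqrt (2 * (k : ℝ) * Real.log (1 / δ))⌉)
    (ν : Measure ℕ) [IsProbabilityMeasure ν] (hν0 : ν {0} = 0)
    (hν : ∀ ℓ : ℕ, 1 ≤ ℓ → ν {ℓ} = (1 / 2 : ℝ≥0∞) ^ ℓ)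
    (ℓ : ℕ) (hℓ : 1 ≤ ℓ) :
    (Measure.pi fun _ : Fin n => ν)
        {L : Fin n → ℕ | k ≤ levelCount n L ℓ (min ((2 ^ ℓ * b).toNat) n)}
      ≤ ENNReal.ofReal δ := by
  obtain ⟨hδ0, hδ1⟩ := hδ
  have hk' : (0 : ℝ) < k := by exact_mod_cast hk
  set a := Real.log (1 / δ) with ha
  have ha0 : 0 < a := Real.log_pos (by rw [lt_div_iff₀ hδ0]; linarith)
  have hδa : δ = Real.exp (-a) := by
    rw [ha, one_div, Real.log_inv, neg_neg, Real.exp_log hδ0]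
  set s := Real.sqrt (2 * (k : ℝ) * a) with hs
  have hs0 : 0 ≤ s := Real.sqrt_nonneg _
  have hss : s ^ 2 = 2 * k * a := Real.sq_sqrt (by positivity)
  have hbs : (b : ℝ) ≤ k - s := by
    have := Int.le_ceil s
    rw [hb]
    push_cast
    linarith
  rcases le_or_gt b 0 with hb0 | hb0
  · have hm : min ((2 ^ ℓ * b).toNat) n = 0 := by
      have : 2 ^ ℓ * b ≤ 0 := mul_nonpos_of_nonneg_of_nonpos (by positivity) hb0
      simp [Int.toNat_of_nonpos this]
    have hempty : {L : Fin n → ℕ | k ≤ levelCount n L ℓ 0} = ∅ := by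
      ext L
      simpa [levelCount] using hk.ne'
    rw [hm, hempty, measure_empty]
    exact zero_le
  have hb0' : (0 : ℝ) < b := by exact_mod_cast hb0
  set m := min ((2 ^ ℓ * b).toNat) n with hm
  have hmb : (m : ℝ) * (1 / 2) ^ ℓ ≤ b := by
    have h1 : (m : ℤ) ≤ 2 ^ ℓ * b := by
      rw [← Int.toNat_of_nonneg (show 0 ≤ 2 ^ ℓ * b by positivity)]
      exact_mod_cast min_le_left _ _
    have h2 : (m : ℝ) ≤ 2 ^ ℓ * b := by exact_mod_cast h1
    calc (m : ℝ) * (1 / 2) ^ ℓ ≤ 2 ^ ℓ * b * (1 / 2) ^ ℓ := by gcongr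
      _ = b := by
        rw [one_div, inv_pow]
        field_simp
  have hνp : ν {ℓ} = ENNReal.ofReal ((1 / 2) ^ ℓ) := by
    rw [hν ℓ hℓ, ENNReal.ofReal_pow (by norm_num), ENNReal.ofReal_div_of_pos (by norm_num)]
    simp
  have hu : (0 : ℝ) ≤ k / b - 1 := by
    rw [sub_nonneg, one_le_div hb0']
    linarith
  refine (measure_le_levelCount_le n k ν ℓ m (by positivity) hu hνp).trans ?_
  rw [hδa]
  refine ENNReal.ofReal_le_ofReal (Real.exp_le_exp.mpr ?_)
  have hlog := Real.add_sq_div_two_le_neg_log_one_sub (x := (k - b) / k)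
    (div_nonneg (by linarith) hk'.le) (by rw [div_lt_one hk']; linarith)
  have hx : 1 - ((k : ℝ) - b) / k = ((k : ℝ) / b)⁻¹ := by
    field_simp
    ring
  rw [hx, Real.log_inv, neg_neg] at hlog
  have hmain : (k - b : ℝ) + a ≤ k * Real.log (k / b) := by
    calc (k - b : ℝ) + a ≤ k * ((k - b) / k + ((k - b) / k) ^ 2 / 2) := by
          have h : a ≤ (k - b : ℝ) ^ 2 / (2 * k) := by
            rw [le_div_iff₀ (by positivity)]
            nlinarith
          have e : k * ((k - b) / k + ((k - b) / k) ^ 2 / 2)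
              = (k - b : ℝ) + (k - b : ℝ) ^ 2 / (2 * k) := by
            field_simp
          linarith
      _ ≤ k * Real.log (k / b) := by gcongr
  have hlin : (m : ℝ) * (1 / 2) ^ ℓ * (k / b - 1) ≤ k - b := by
    calc (m : ℝ) * (1 / 2) ^ ℓ * (k / b - 1) ≤ b * (k / b - 1) := by gcongr
      _ = k - b := by field_simp
  rw [add_sub_cancel]
  linarith
end

section
/- Let n, k be positive integers with k ≤ n, let δ ∈ (0,1) with k ≥ 8·log(1/δ), and set ℓ* = ⌊log₂(n/k)⌋. With levels ℓ_1,…,ℓ_n independently distributed as Pr(ℓ_i = ℓ) = 2^{-ℓ}, the probability that at least k of the n points are assigned a level ≥ ℓ* + 3 is at most δ. -/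
open MeasureTheory
open scoped ENNReal

lemma measureReal_Ici_of_geometric (ν : Measure ℕ) [IsProbabilityMeasure ν] (hν0 : ν {0} = 0)
    (hν : ∀ ℓ : ℕ, 1 ≤ ℓ → ν {ℓ} = (1 / 2 : ℝ≥0∞) ^ ℓ) (m : ℕ) :
    ν.real (Set.Ici (m + 1)) = (1 / 2 : ℝ) ^ m := by
  have split (m : ℕ) : ν.real (Set.Ici m) = ν.real {m} + ν.real (Set.Ici (m + 1)) := by
    rw [← measureReal_union (by simp) (MeasurableSet.of_discrete)]
    congr 1
    ext x
    simp only [Set.mem_Ici, Set.mem_union, Set.mem_singleton_iff]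
    omega
  induction m with
  | zero =>
    have h := split 0
    have h0 : (Set.Ici 0 : Set ℕ) = Set.univ := by ext; simp
    rw [h0, probReal_univ, measureReal_def, hν0] at h
    simpa using h.symm
  | succ m ih =>
    have h := split (m + 1)
    rw [ih, measureReal_def, hν (m + 1) (by omega)] at h
    have h1 : ((1 / 2 : ℝ≥0∞) ^ (m + 1)).toReal = (1 / 2 : ℝ) ^ (m + 1) := by simp
    rw [h1, pow_succ] at h
    rw [pow_succ]
    linarith

/-- A Chernoff bound: among `n` independent trials of success probability `ν A`, the number of
successes is at least `k` with probability at most `(1 + ν A) ^ n / 2 ^ k`. -/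
lemma measure_pi_le_ncard_le (n k : ℕ) (ν : Measure ℕ) [IsProbabilityMeasure ν] (A : Set ℕ) :
    (Measure.pi fun _ : Fin n => ν) {L : Fin n → ℕ | k ≤ Set.ncard {j : Fin n | L j ∈ A}}
      ≤ (1 + ν A) ^ n / 2 ^ k := by
  classical
  let f : ℕ → ℝ≥0∞ := fun m => 1 + A.indicator 1 m
  have hf : ∫⁻ m, f m ∂ν = 1 + ν A := by
    rw [lintegral_add_left measurable_const, lintegral_indicator_one MeasurableSet.of_discrete]
    simp
  have hprod (L : Fin n → ℕ) : ∏ j, f (L j) = 2 ^ Set.ncard {j : Fin n | L j ∈ A} := by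
    have hfe (m : ℕ) : f m = if m ∈ A then 2 else 1 := by
      by_cases h : m ∈ A <;> simp [f, h, one_add_one_eq_two]
    simp only [hfe]
    rw [Finset.prod_ite, Finset.prod_const_one, mul_one, Finset.prod_const,
      ← Set.ncard_coe_finset]
    simp
  have hmeas (j : Fin n) : Measurable fun L : Fin n → ℕ => f (L j) :=
    (measurable_from_nat (f := f)).comp (measurable_pi_apply j)
  have hint : ∫⁻ L : Fin n → ℕ, ∏ j, f (L j) ∂(Measure.pi fun _ : Fin n => ν)
      = (1 + ν A) ^ n := by
    have hind : ProbabilityTheory.iIndepFun (fun (j : Fin n) (L : Fin n → ℕ) => f (L j))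
        (Measure.pi fun _ : Fin n => ν) :=
      ProbabilityTheory.iIndepFun_pi fun _ => (measurable_from_nat (f := f)).aemeasurable
    rw [ProbabilityTheory.lintegral_prod_eq_prod_lintegral_of_indepFun _ _ hind hmeas]
    have heval (j : Fin n) :
        ∫⁻ L : Fin n → ℕ, f (L j) ∂(Measure.pi fun _ : Fin n => ν) = 1 + ν A := by
      rw [← hf]
      exact (measurePreserving_eval (fun _ : Fin n => ν) j).lintegral_comp measurable_from_nat
    simp [heval]
  rw [← hint]
  refine le_trans (measure_mono ?_) (meas_ge_le_lintegral_div
    (Finset.measurable_fun_prod _ fun j _ => hmeas j).aemeasurable (by simp) (by simp))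
  intro L hL
  simp only [Set.mem_ofPred_eq] at hL ⊢
  rw [hprod]
  exact pow_le_pow_right₀ (by norm_num) hL

lemma one_add_pow_div_two_pow_le (n k : ℕ) (p δ : ℝ) (hp : 0 ≤ p) (hpn : n * p ≤ k / 2)
    (hδ : 0 < δ) (h8 : 8 * Real.log (1 / δ) ≤ (k : ℝ)) :
    (1 + p) ^ n / 2 ^ k ≤ δ := by
  have h1 : (1 + p) ^ n ≤ Real.exp (k / 2) := calc
    (1 + p) ^ n ≤ Real.exp p ^ n := by
      gcongr
      linarith [Real.add_one_le_exp p]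
    _ = Real.exp (n * p) := (Real.exp_nat_mul p n).symm
    _ ≤ _ := Real.exp_le_exp.2 hpn
  have h2 : (2 : ℝ) ^ k = Real.exp (k * Real.log 2) := by
    rw [Real.exp_nat_mul, Real.exp_log (by norm_num)]
  rw [one_div, Real.log_inv] at h8
  calc (1 + p) ^ n / 2 ^ k ≤ Real.exp (k / 2) / Real.exp (k * Real.log 2) := by
        rw [h2]; gcongr
    _ = Real.exp (k / 2 - k * Real.log 2) := (Real.exp_sub _ _).symm
    _ ≤ Real.exp (Real.log δ) := by
        refine Real.exp_le_exp.2 ?_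
        nlinarith [Real.log_two_gt_d9, Nat.cast_nonneg (α := ℝ) k]
    _ = δ := Real.exp_log hδ

/-- Let `n, k` be positive integers with `k ≤ n`, let `δ ∈ (0,1)` with
`k ≥ 8·log(1/δ)`, and set `ℓ* = ⌊log₂(n/k)⌋`. With levels `ℓ_1,…,ℓ_n` independently
distributed as `Pr(ℓ_i = ℓ) = 2^{−ℓ}` (encoded by the product measure
`Measure.pi (fun _ => ν)` of a probability measure `ν` on `ℕ` with `ν {0} = 0` and
`ν {ℓ} = 2^{−ℓ}` for `ℓ ≥ 1`), the probability that at least `k` of the `n` points are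
assigned a level `≥ ℓ* + 3` is at most `δ`. -/
theorem stmt_7 (n k : ℕ) (hn : 0 < n) (hk : 0 < k) (hkn : k ≤ n)
    (δ : ℝ) (hδ : δ ∈ Set.Ioo (0 : ℝ) 1)
    (h8 : 8 * Real.log (1 / δ) ≤ (k : ℝ))
    (lstar : ℤ) (hlstar : lstar = ⌊Real.logb 2 ((n : ℝ) / (k : ℝ))⌋)
    (ν : Measure ℕ) [IsProbabilityMeasure ν] (hν0 : ν {0} = 0)
    (hν : ∀ ℓ : ℕ, 1 ≤ ℓ → ν {ℓ} = (1 / 2 : ℝ≥0∞) ^ ℓ) :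
    (Measure.pi fun _ : Fin n => ν)
        {L : Fin n → ℕ | k ≤ Set.ncard {j : Fin n | lstar + 3 ≤ (L j : ℤ)}}
      ≤ ENNReal.ofReal δ := by
  have hn' : (0 : ℝ) < n := by exact_mod_cast hn
  have hk' : (0 : ℝ) < k := by exact_mod_cast hk
  have hnonneg : 0 ≤ lstar := by
    rw [hlstar]
    refine Int.floor_nonneg.2 (Real.logb_nonneg (by norm_num) ?_)
    rw [one_le_div hk']
    exact_mod_cast hkn
  obtain ⟨s, rfl⟩ := Int.eq_ofNat_of_zero_le hnonneg
  have hlt : (n : ℝ) / k < 2 ^ (s + 1) := by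
    have h := Int.lt_floor_add_one (Real.logb 2 ((n : ℝ) / k))
    rw [← hlstar, Real.logb_lt_iff_lt_rpow (by norm_num) (by positivity)] at h
    exact_mod_cast h
  have hset : {L : Fin n → ℕ | k ≤ Set.ncard {j : Fin n | (s : ℤ) + 3 ≤ (L j : ℤ)}}
      = {L : Fin n → ℕ | k ≤ Set.ncard {j : Fin n | L j ∈ Set.Ici (s + 2 + 1)}} := by
    ext L
    have h (j : Fin n) : (s : ℤ) + 3 ≤ (L j : ℤ) ↔ s + 2 + 1 ≤ L j := by omega
    simp only [Set.mem_ofPred_eq, h, Set.mem_Ici]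
  have hp := measureReal_Ici_of_geometric ν hν0 hν (s + 2)
  have hpE : ν (Set.Ici (s + 2 + 1)) = ENNReal.ofReal ((1 / 2) ^ (s + 2)) := by
    rw [← hp, ofReal_measureReal]
  rw [hset]
  refine (measure_pi_le_ncard_le n k ν _).trans ?_
  have hreal : (1 + ν (Set.Ici (s + 2 + 1))) ^ n / 2 ^ k
      = ENNReal.ofReal ((1 + (1 / 2) ^ (s + 2)) ^ n / 2 ^ k) := by
    rw [hpE, ENNReal.ofReal_div_of_pos (by positivity),
      ENNReal.ofReal_pow (p := 1 + _) (by positivity),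
      ENNReal.ofReal_add (by norm_num) (by positivity), ENNReal.ofReal_one,
      ENNReal.ofReal_pow (p := 2) (by norm_num), ENNReal.ofReal_ofNat]
  rw [hreal]
  refine ENNReal.ofReal_le_ofReal
    (one_add_pow_div_two_pow_le n k _ δ (by positivity) ?_ hδ.1 h8)
  rw [div_lt_iff₀ hk'] at hlt
  rw [one_div, inv_pow, ← div_eq_mul_inv, div_le_iff₀ (by positivity)]
  calc (n : ℝ) ≤ 2 ^ (s + 1) * k := hlt.le
    _ = k / 2 * 2 ^ (s + 2) := by ring
end

section
/- Fix positive integers k and b and a (deterministic) level assignment ℓ_1,…,ℓ_n ∈ {1,2,3,…} such that for every level ℓ ≥ 1, C_{ℓ, min(2^ℓ·b, n)} < k. With p_i = ∑_{ℓ ≥ 1 : C_{ℓ,i-1} < k} 2^{-ℓ}, for every m ≤ n it holds that ∑_{i=1}^m (1/p_i − 1) ≤ (3/8)·m²/b. -/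
theorem levelCount_mono_s11 (n : ℕ) (L : Fin n → ℕ) (ℓ : ℕ) : Monotone (levelCount n L ℓ) := by
  intro i i' h
  refine Finset.card_le_card fun j hj => ?_
  simp only [Finset.mem_filter, Finset.mem_univ, true_and] at hj ⊢
  exact ⟨hj.1.trans_le h, hj.2⟩

/-- If every level above `j` is still open, then `p ≥ 2^{-j}`. -/
theorem half_pow_le_pVal {n k : ℕ} {L : Fin n → ℕ} {i j : ℕ}
    (h : ∀ ℓ, j < ℓ → levelCount n L ℓ i < k) : (1 / 2 : ℝ) ^ j ≤ pVal n k L i := by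
  have hgeom : HasSum (fun ℓ : ℕ => (1 / 2 : ℝ) ^ (ℓ + 1)) 1 := by
    simpa [pow_succ'] using hasSum_geometric_two.mul_left (1 / 2 : ℝ)
  have hsum : Summable fun ℓ : ℕ =>
      if levelCount n L (ℓ + 1) i < k then (1 / 2 : ℝ) ^ (ℓ + 1) else 0 := by
    refine hgeom.summable.of_nonneg_of_le (fun ℓ => ?_) (fun ℓ => ?_)
    · split_ifs <;> positivity
    · split_ifs
      · exact le_rfl
      · positivity
  have htail : ∑' ℓ : ℕ, (if levelCount n L (ℓ + j + 1) i < k then (1 / 2 : ℝ) ^ (ℓ + j + 1)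
      else 0) = (1 / 2 : ℝ) ^ j := by
    rw [← mul_one ((1 / 2 : ℝ) ^ j), ← (hgeom.mul_left ((1 / 2 : ℝ) ^ j)).tsum_eq]
    refine tsum_congr fun ℓ => ?_
    rw [if_pos (h _ (by omega))]
    ring
  rw [pVal, ← hsum.sum_add_tsum_nat_add j, htail]
  refine le_add_of_nonneg_left (Finset.sum_nonneg fun ℓ _ => ?_)
  split_ifs <;> positivity

/-- Over `m ∈ [2^j b, 2^{j+1} b]`, partial sums of a sequence which is at most `2^i - 1` up to each
index `2^{i+1} b` are dominated by an affine function of `m`. -/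
theorem sum_le_affine_of_dyadic_bound {f : ℕ → ℝ} {n b : ℕ}
    (hf : ∀ i j : ℕ, i < n → i ≤ 2 ^ (j + 1) * b → f i ≤ 2 ^ j - 1) (j : ℕ) :
    ∀ m : ℕ, 2 ^ j * b ≤ m → m ≤ 2 ^ (j + 1) * b → m ≤ n →
      ∑ i ∈ Finset.range m, f i ≤ (2 ^ j - 1) * (m : ℝ) - 2 / 3 * (4 ^ j - 1) * (b : ℝ) := by
  induction j with
  | zero =>
    intro m _ hm hn
    have : ∑ i ∈ Finset.range m, f i ≤ 0 := by
      refine Finset.sum_nonpos fun i hi => ?_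
      have hi := Finset.mem_range.1 hi
      simpa using hf i 0 (by omega) (by omega)
    simpa using this
  | succ j ih =>
    intro m hlow
    induction m, hlow using Nat.le_induction with
    | base =>
      intro _ hn
      refine (ih _ (Nat.mul_le_mul_right b (Nat.pow_le_pow_right two_pos j.le_succ)) le_rfl
        hn).trans_eq ?_
      have h4 : (4 : ℝ) ^ j = 2 ^ j * 2 ^ j := by rw [← mul_pow]; norm_num
      push_cast
      rw [pow_succ, pow_succ, h4]
      ring
    | succ m _ ihm =>
      intro hm hn
      rw [Finset.sum_range_succ]
      have h1 := ihm (by omega) (by omega)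
      have h2 := hf m (j + 1) (by omega) (by omega)
      push_cast
      linarith

/-- Fix positive integers `k` and `b` and a deterministic level assignment
`ℓ_1,…,ℓ_n ∈ {1,2,3,…}` such that for every level `ℓ ≥ 1`, `C_{ℓ, min(2^ℓ·b, n)} < k`.
Then for every `m ≤ n`, `∑_{i=1}^m (1/p_i − 1) ≤ (3/8)·m²/b`.
(The sum over 1-based point indices `i = 1,…,m` is written via the number of previous
points `i − 1 ∈ {0,…,m−1}`, i.e. `Finset.range m`.) -/
theorem stmt_11 (n k b : ℕ) (hk : 0 < k) (hb : 0 < b)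
    (L : Fin n → ℕ) (hL : ∀ j, 1 ≤ L j)
    (hgood : ∀ ℓ : ℕ, 1 ≤ ℓ → levelCount n L ℓ (min (2 ^ ℓ * b) n) < k)
    (m : ℕ) (hm : m ≤ n) :
    ∑ i ∈ Finset.range m, (1 / pVal n k L i - 1) ≤ 3 / 8 * (m : ℝ) ^ 2 / (b : ℝ) := by
  have hf : ∀ i j : ℕ, i < n → i ≤ 2 ^ (j + 1) * b → 1 / pVal n k L i - 1 ≤ 2 ^ j - 1 := by
    intro i j hi hij
    have hp : (1 / 2 : ℝ) ^ j ≤ pVal n k L i := half_pow_le_pVal fun ℓ hℓ =>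
      (levelCount_mono_s11 n L ℓ (le_min (hij.trans
        (Nat.mul_le_mul_right b (Nat.pow_le_pow_right two_pos hℓ))) hi.le)).trans_lt
          (hgood ℓ (by omega))
    have := one_div_le_one_div_of_le (by positivity) hp
    simp only [one_div, inv_pow, inv_inv] at this ⊢
    linarith
  have hb' : (0 : ℝ) < b := by exact_mod_cast hb
  rcases lt_or_ge m b with hmb | hmb
  · refine (Finset.sum_nonpos fun i hi => ?_).trans (by positivity)
    have hi := Finset.mem_range.1 hi
    simpa using hf i 0 (by omega) (by omega)
  · have hq : m / b ≠ 0 := (Nat.div_pos hmb hb).ne'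
    set j := Nat.log 2 (m / b)
    have hlow : 2 ^ j * b ≤ m := (Nat.le_div_iff_mul_le hb).1 (Nat.pow_log_le_self 2 hq)
    have hhigh : m < 2 ^ (j + 1) * b :=
      (Nat.div_lt_iff_lt_mul hb).1 (Nat.lt_pow_succ_log_self one_lt_two _)
    refine (sum_le_affine_of_dyadic_bound hf j m hlow hhigh.le hm).trans ?_
    have hmb' : (b : ℝ) ≤ m := by exact_mod_cast hmb
    have h4 : (4 : ℝ) ^ j = 2 ^ j * 2 ^ j := by rw [← mul_pow]; norm_num
    rw [le_div_iff₀ hb', h4]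
    nlinarith [sq_nonneg ((m : ℝ) - 4 / 3 * 2 ^ j * b), mul_le_mul_of_nonneg_right hmb' hb'.le,
      mul_pos hb' hb']
end

section
/- Let b be a positive integer, let w_1,…,w_n ≥ 0 be nonnegative reals such that ∑_{i=1}^m w_i ≤ (3/8)·m²/b for every m ∈ {1,…,n}, and let f_1 ≥ f_2 ≥ … ≥ f_n ≥ 0 be nonnegative reals in nonincreasing order with F = ∑_{i=1}^n f_i. Then ∑_{i=1}^n w_i·f_i² ≤ (3/8)·F²/b. -/
theorem sum_filter_val_lt_succ {n m : ℕ} (hm : m < n) (g : Fin n → ℝ) :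
    ∑ i ∈ Finset.univ.filter (fun i : Fin n => (i : ℕ) < m + 1), g i =
      ∑ i ∈ Finset.univ.filter (fun i : Fin n => (i : ℕ) < m), g i + g ⟨m, hm⟩ := by
  have h : Finset.univ.filter (fun i : Fin n => (i : ℕ) < m + 1) =
      insert ⟨m, hm⟩ (Finset.univ.filter (fun i : Fin n => (i : ℕ) < m)) := by
    ext i
    simp only [Finset.mem_filter, Finset.mem_univ, true_and, Finset.mem_insert, Fin.ext_iff]
    omega
  rw [h, Finset.sum_insert (by simp), add_comm]

/-- Summation by parts as an induction over prefixes: `t` is any lower bound for the first `m`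
values, and the unused weight budget `c * m ^ 2 - ∑ w` may be spent at height `t`. -/
theorem sum_mul_sq_add_slack_le {n : ℕ} {c : ℝ} (hc : 0 ≤ c) {w f : Fin n → ℝ}
    (hwsum : ∀ m : ℕ, 1 ≤ m → m ≤ n →
      ∑ i ∈ Finset.univ.filter (fun i : Fin n => (i : ℕ) < m), w i ≤ c * (m : ℝ) ^ 2)
    (hmono : Antitone f) (hf : ∀ i, 0 ≤ f i) (m : ℕ) (hm : m ≤ n) (t : ℝ) (ht : 0 ≤ t)
    (htf : ∀ i : Fin n, (i : ℕ) < m → t ≤ f i) :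
    m * t ≤ ∑ i ∈ Finset.univ.filter (fun i : Fin n => (i : ℕ) < m), f i ∧
    ∑ i ∈ Finset.univ.filter (fun i : Fin n => (i : ℕ) < m), w i * f i ^ 2 +
        (c * (m : ℝ) ^ 2 - ∑ i ∈ Finset.univ.filter (fun i : Fin n => (i : ℕ) < m), w i) * t ^ 2 ≤
      c * (∑ i ∈ Finset.univ.filter (fun i : Fin n => (i : ℕ) < m), f i) ^ 2 := by
  induction m generalizing t with
  | zero => simp
  | succ m ih =>
    have hmn : m < n := hm
    obtain ⟨hS, hV⟩ := ih hmn.le (f ⟨m, hmn⟩) (hf _) fun i hi => hmono (Fin.mk_le_mk.2 hi.le)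
    have hW := hwsum (m + 1) (by omega) hm
    have htm : t ≤ f ⟨m, hmn⟩ := htf ⟨m, hmn⟩ (Nat.lt_succ_self m)
    have hfm := hf ⟨m, hmn⟩
    rw [sum_filter_val_lt_succ hmn] at hW
    simp only [sum_filter_val_lt_succ hmn]
    push_cast at hW ⊢
    generalize f ⟨m, hmn⟩ = x at *
    generalize w ⟨m, hmn⟩ = y at *
    have hsq : t ^ 2 ≤ x ^ 2 := pow_le_pow_left₀ ht htm 2
    have hslack := mul_le_mul_of_nonneg_left hsq (sub_nonneg.2 hW)
    have hcross := mul_le_mul_of_nonneg_left (mul_le_mul_of_nonneg_right hS hfm) hc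
    have hmt : (m : ℝ) * t ≤ m * x := mul_le_mul_of_nonneg_left htm m.cast_nonneg
    exact ⟨by linarith, by linarith⟩

/-- Let `b` be a positive integer, let `w_1,…,w_n ≥ 0` be nonnegative
reals such that `∑_{i=1}^m w_i ≤ (3/8)·m²/b` for every `m ∈ {1,…,n}`, and let
`f_1 ≥ … ≥ f_n ≥ 0` be nonnegative reals in nonincreasing order with `F = ∑ f_i`.
Then `∑ w_i·f_i² ≤ (3/8)·F²/b`.
(Indices are 0-based via `Fin n`; "the first `m` values" are those with `(i : ℕ) < m`.) -/
theorem stmt_12 (n b : ℕ) (hb : 0 < b) (w f : Fin n → ℝ)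
    (hw : ∀ i, 0 ≤ w i)
    (hwsum : ∀ m : ℕ, 1 ≤ m → m ≤ n →
      ∑ i ∈ Finset.univ.filter (fun i : Fin n => (i : ℕ) < m), w i ≤ 3 / 8 * (m : ℝ) ^ 2 / b)
    (hmono : ∀ i j : Fin n, i ≤ j → f j ≤ f i)
    (hf : ∀ i, 0 ≤ f i) :
    ∑ i, w i * f i ^ 2 ≤ 3 / 8 * (∑ i, f i) ^ 2 / b := by
  have h := (sum_mul_sq_add_slack_le (c := 3 / 8 / b) (by positivity)
    (fun m h1 h2 => (hwsum m h1 h2).trans_eq (by ring)) hmono hf n le_rfl 0 le_rfl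
    fun i _ => hf i).2
  simp only [Fin.is_lt, Finset.filter_true] at h
  calc ∑ i, w i * f i ^ 2 ≤ 3 / 8 / b * (∑ i, f i) ^ 2 := by simpa using h
    _ = 3 / 8 * (∑ i, f i) ^ 2 / b := by ring
end

section
/- Let f_1 ≥ f_2 ≥ … ≥ f_n ≥ 0 be nonnegative reals in nonincreasing order and let a be an integer with 1 ≤ a ≤ n satisfying n(n+1) ≤ 4a·(n − a + 1). Then (n(n+1)/(4a))·∑_{i=n−a+1}^n f_i ≤ ∑_{i=1}^n i·f_i. Moreover, a = ⌈n/2⌉ satisfies n(n+1) ≤ 4a·(n − a + 1). -/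
theorem Nat.ceil_cast_div_two (n : ℕ) : ⌈(n : ℝ) / 2⌉₊ = (n + 1) / 2 := by
  apply le_antisymm
  · rw [Nat.ceil_le, div_le_iff₀ two_pos]
    exact_mod_cast (by omega : n ≤ (n + 1) / 2 * 2)
  · have h : (n : ℝ) ≤ (⌈(n : ℝ) / 2⌉₊ : ℝ) * 2 := by
      rw [← div_le_iff₀ two_pos]
      exact Nat.le_ceil _
    have h' : n ≤ ⌈(n : ℝ) / 2⌉₊ * 2 := by exact_mod_cast h
    omega

theorem mul_succ_le_four_mul_ceil_half (n : ℕ) :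
    (n : ℝ) * (n + 1) ≤ 4 * (⌈(n : ℝ) / 2⌉₊ : ℝ) * ((n : ℝ) - ⌈(n : ℝ) / 2⌉₊ + 1) := by
  rw [Nat.ceil_cast_div_two]
  obtain ⟨k, rfl | rfl⟩ := n.even_or_odd'
  · rw [show (2 * k + 1) / 2 = k by omega]
    push_cast
    nlinarith [k.cast_nonneg (α := ℝ)]
  · rw [show (2 * k + 1 + 1) / 2 = k + 1 by omega]
    push_cast
    nlinarith [k.cast_nonneg (α := ℝ)]

theorem mul_sum_filter_le_sum_succ_mul {n m : ℕ} {f : Fin n → ℝ} (hf : ∀ i, 0 ≤ f i)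
    {c : ℝ} (hc : c ≤ m + 1) :
    c * ∑ i ∈ Finset.univ.filter (fun i : Fin n => m ≤ (i : ℕ)), f i
      ≤ ∑ i : Fin n, ((i : ℕ) + 1 : ℝ) * f i := by
  rw [Finset.mul_sum]
  refine (Finset.sum_le_sum fun i hi => ?_).trans
    (Finset.sum_le_sum_of_subset_of_nonneg (Finset.filter_subset _ _)
      fun i _ _ => mul_nonneg (by positivity) (hf i))
  have hmi : (m : ℝ) ≤ (i : ℕ) := by exact_mod_cast (Finset.mem_filter.mp hi).2
  exact mul_le_mul_of_nonneg_right (by linarith) (hf i)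

/-- Let `f_1 ≥ f_2 ≥ … ≥ f_n ≥ 0` be nonnegative reals in nonincreasing
order and let `a` be an integer with `1 ≤ a ≤ n` satisfying `n(n+1) ≤ 4a·(n − a + 1)`.
Then `(n(n+1)/(4a))·∑_{i=n−a+1}^n f_i ≤ ∑_{i=1}^n i·f_i`.
Moreover, `a = ⌈n/2⌉` satisfies `n(n+1) ≤ 4a·(n − a + 1)`.
(Indices are 0-based via `Fin n`, so the 1-based index of `i : Fin n` is `i + 1`, and the
`a` smallest values are those with 1-based index `≥ n − a + 1`, i.e. `(i : ℕ) ≥ n − a`.) -/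
theorem stmt_17 (n : ℕ) (hn : 0 < n) (f : Fin n → ℝ)
    (hmono : ∀ i j : Fin n, i ≤ j → f j ≤ f i)
    (hf : ∀ i, 0 ≤ f i)
    (a : ℕ) (ha1 : 1 ≤ a) (han : a ≤ n)
    (hcond : (n : ℝ) * (n + 1) ≤ 4 * a * ((n : ℝ) - a + 1)) :
    ((n : ℝ) * (n + 1) / (4 * a)) *
        ∑ i ∈ Finset.univ.filter (fun i : Fin n => n - a ≤ (i : ℕ)), f i
      ≤ ∑ i : Fin n, ((i : ℕ) + 1 : ℝ) * f i ∧
    (n : ℝ) * (n + 1) ≤ 4 * (⌈(n : ℝ) / 2⌉₊ : ℝ) * ((n : ℝ) - ⌈(n : ℝ) / 2⌉₊ + 1) := by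
  refine ⟨mul_sum_filter_le_sum_succ_mul hf ?_, mul_succ_le_four_mul_ceil_half n⟩
  have ha : (0 : ℝ) < a := by exact_mod_cast ha1
  rw [Nat.cast_sub han, div_le_iff₀ (by positivity)]
  linarith
end
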